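/- Let r ∈ ℕ, let p_1,…,p_r be integral polynomials with zero constant term, set P = (p_1,…,p_r), and let R ⊆ ℕ. Then the following are equivalent: (1) for every Weyl system (X,μ,T) and every Borel set A ⊆ X with μ(A) > 0 there exists n ∈ R with μ(A ∩ T^{−p_1(n)}A ∩ ⋯ ∩ T^{−p_r(n)}A) > 0; (2) for every Weyl system (X,μ,T) and every nonempty open set U ⊆ X there exists n ∈ R with U ∩ T^{−p_1(n)}U ∩ ⋯ ∩ T^{−p_r(n)}U ≠ ∅; (3) for every d, s ∈ ℕ, every β_1,…,β_s ∈ 𝕋, every finite list q_1,…,q_m of integral polynomials belonging to WP_d(P), and every ε > 0, there exists n ∈ R such that ‖q_i(n)β_j‖ < ε for all 1 ≤ i ≤ m and 1 ≤ j ≤ s. -/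

import Mathlib

open MeasureTheory Polynomial Filter

noncomputable section

/-- An integral polynomial: a real polynomial taking integer values on the integers. -/
def IsIntegralPoly (p : Polynomial ℝ) : Prop := ∀ n : ℤ, ∃ m : ℤ, p.eval (n : ℝ) = (m : ℝ)

/-- The integer value of an (integral) polynomial at an integer. -/
def ieval (p : Polynomial ℝ) (n : ℤ) : ℤ := ⌊p.eval (n : ℝ)⌋

/-- A family of polynomials is essentially distinct if each member and each
difference of two distinct members is non-constant. -/
def EssentiallyDistinct {r : ℕ} (P : Fin r → Polynomial ℝ) : Prop :=
  (∀ i, 0 < (P i).natDegree) ∧ ∀ i j, i ≠ j → 0 < (P i - P j).natDegree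

/-- `p^[j]`: the polynomial `x ↦ p(x)(p(x)-1)⋯(p(x)-j+1)/j!`. -/
def pbr (p : Polynomial ℝ) (j : ℕ) : Polynomial ℝ :=
  Polynomial.C (1 / (Nat.factorial j : ℝ)) * ∏ i ∈ Finset.range j, (p - Polynomial.C (i : ℝ))

/-- The matrix `Λ_k(P)(x)`.  Rows are indexed by pairs `(i, m) ∈ Fin k × Fin r`
(zero-based), the pair `(i, m)` corresponding to row `i·r + m + 1` in the one-based
numbering: the entry in row `(i, m)` and column `c` is `p_m^{[i−c+1]}(x)` if `c ≤ i`
and `0` otherwise. -/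
def Lam {r : ℕ} (P : Fin r → Polynomial ℝ) (k : ℕ) (x : ℝ) :
    Matrix (Fin k × Fin r) (Fin k) ℝ := fun ρ c =>
  if (c : ℕ) ≤ (ρ.1 : ℕ) then (pbr (P ρ.2) ((ρ.1 : ℕ) - (c : ℕ) + 1)).eval x else 0

/-- The `k`-Weyl polynomials generated by the family `P` (with `WP P 0 = {0}`
by convention).  `WP P 1` is the real span of the members of `P`; for `k ≥ 2`,
`WP P k` is the set of real polynomials of the form `x ↦ (vᵀ Λ_k(P)(x))₁` where
`v ∈ ℝ^{kr}` is such that its vector `w` of last `(k−1)r` coordinates satisfies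
`wᵀ Λ_{k−1}(P)(x) = 0` for all `x`. -/
def WP {r : ℕ} (P : Fin r → Polynomial ℝ) : ℕ → Set (Polynomial ℝ)
  | 0 => {0}
  | 1 => (Submodule.span ℝ (Set.range P) : Submodule ℝ (Polynomial ℝ))
  | (k + 2) => { q | ∃ v : Fin (k + 2) × Fin r → ℝ,
      (∀ x : ℝ, Matrix.vecMul (fun w : Fin (k + 1) × Fin r => v (w.1.succ, w.2))
          (Lam P (k + 1) x) = 0) ∧
      ∀ x : ℝ, q.eval x = Matrix.vecMul v (Lam P (k + 2) x) 0 }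

end

noncomputable section

abbrev Torus := AddCircle (1 : ℝ)

/-- The Haar probability measure on `𝕋^N × F` (`F` a finite group):
the product of the Haar measure on `𝕋^N` and the uniform measure on `F`. -/
def weylMeasure (N : ℕ) (F : Type) [Fintype F] [MeasurableSpace F] :
    Measure ((Fin N → Torus) × F) :=
  (volume : Measure (Fin N → Torus)).prod
    ((Fintype.card F : ENNReal)⁻¹ • Measure.count)

/-- The transformation `x ↦ a + U x` of a Weyl system, as a bijection. -/
def weylT {N : ℕ} {F : Type} [AddCommGroup F]
    (a : (Fin N → Torus) × F)
    (U : ((Fin N → Torus) × F) ≃+ ((Fin N → Torus) × F)) :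
    Equiv.Perm ((Fin N → Torus) × F) :=
  U.toEquiv.trans (Equiv.addLeft a)

/-- `(X, μ, T)` with `X = 𝕋^N × F`, `μ` Haar, `T = a + U(·)`, is a Weyl system with
unipotent integer matrix `A`: `U` is a continuous automorphism restricting to `A` on
the identity component, `A` is unipotent, and `T` is ergodic for `μ`. -/
def IsWeylSystemWith {N : ℕ} {F : Type} [AddCommGroup F] [Fintype F]
    [TopologicalSpace F] [MeasurableSpace F]
    (a : (Fin N → Torus) × F)
    (U : ((Fin N → Torus) × F) ≃+ ((Fin N → Torus) × F))
    (A : Matrix (Fin N) (Fin N) ℤ) : Prop :=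
  (A - 1) ^ N = 0 ∧
  Continuous ⇑U ∧
  (∀ x : Fin N → Torus, U (x, (0 : F)) = (fun j => ∑ i, A j i • x i, (0 : F))) ∧
  Ergodic (⇑(weylT a U)) (weylMeasure N F)


end

noncomputable section

/-! ### Integral polynomials and Weyl polynomials -/

lemma IsIntegralPoly.cast_ieval {p : ℝ[X]} (hp : IsIntegralPoly p) (n : ℤ) :
    ((ieval p n : ℤ) : ℝ) = p.eval (n : ℝ) := by
  obtain ⟨m, hm⟩ := hp n
  simp [ieval, hm]

lemma ieval_eq_of_eval {p : ℝ[X]} {n m : ℤ} (h : p.eval (n : ℝ) = m) : ieval p n = m := by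
  simp [ieval, h]

lemma Polynomial.eq_of_eval_intCast_eq {p q : ℝ[X]}
    (h : ∀ n : ℤ, p.eval (n : ℝ) = q.eval (n : ℝ)) : p = q := by
  refine Polynomial.eq_of_infinite_eval_eq p q
    ((Set.infinite_range_of_injective (Int.cast_injective (α := ℝ))).mono ?_)
  rintro _ ⟨n, rfl⟩
  exact h n

lemma prod_range_sub_eq_factorial_mul_choose (a : ℤ) (j : ℕ) :
    ∏ i ∈ Finset.range j, (a - i) = j.factorial * Ring.choose a j := by
  rw [← nsmul_eq_mul, ← Ring.descPochhammer_eq_factorial_smul_choose, ← Polynomial.eval_eq_smeval,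
    descPochhammer_eval_eq_prod_range]

lemma eval_pbr {p : ℝ[X]} (hp : IsIntegralPoly p) (j : ℕ) (n : ℤ) :
    (pbr p j).eval (n : ℝ) = (Ring.choose (ieval p n) j : ℤ) := by
  have h := congrArg (Int.cast : ℤ → ℝ) (prod_range_sub_eq_factorial_mul_choose (ieval p n) j)
  push_cast at h
  simp only [pbr, eval_mul, eval_C, eval_prod, eval_sub]
  rw [← hp.cast_ieval, h]
  have : (j.factorial : ℝ) ≠ 0 := by positivity
  field_simp

section WeylPoly

variable {r : ℕ} (P : Fin r → ℝ[X])

/-- The entry in column `c` of the row vector `vᵀ Λ_k(P)`, as a polynomial. -/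
def weylPoly (v : ℕ → Fin r → ℝ) (k c : ℕ) : ℝ[X] :=
  ∑ i ∈ Finset.range k,
    if c ≤ i then ∑ m, C (v i m) * pbr (P m) (i - c + 1) else 0

/-- The coefficient vectors `v` for which all columns of `vᵀ Λ_k(P)` but the first vanish. -/
def IsWeylVector (k : ℕ) (v : ℕ → Fin r → ℝ) : Prop :=
  ∀ c, c + 1 < k → weylPoly P v k (c + 1) = 0

variable {P}

lemma eval_weylPoly (hP : ∀ k, IsIntegralPoly (P k)) (v : ℕ → Fin r → ℝ) (k c : ℕ) (n : ℤ) :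
    (weylPoly P v k c).eval (n : ℝ) = ∑ i ∈ Finset.range k,
      if c ≤ i then ∑ m, v i m * (Ring.choose (ieval (P m) n) (i - c + 1) : ℤ) else 0 := by
  rw [weylPoly, eval_finsetSum]
  refine Finset.sum_congr rfl fun i _ => ?_
  split_ifs
  · rw [eval_finsetSum]
    exact Finset.sum_congr rfl fun m _ => by rw [eval_mul, eval_C, eval_pbr (hP m)]
  · simp

lemma weylPoly_succ (v : ℕ → Fin r → ℝ) (k c : ℕ) :
    weylPoly P v (k + 1) (c + 1) = weylPoly P (fun i => v (i + 1)) k c := by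
  simp [weylPoly, Finset.sum_range_succ']

lemma vecMul_Lam (v : ℕ → Fin r → ℝ) (k : ℕ) (x : ℝ) (c : Fin k) :
    Matrix.vecMul (fun ρ : Fin k × Fin r => v ρ.1 ρ.2) (Lam P k x) c
      = (weylPoly P v k c).eval x := by
  simp only [Matrix.vecMul, dotProduct, Lam, weylPoly, eval_finsetSum, Fintype.sum_prod_type]
  rw [Finset.sum_range]
  refine Finset.sum_congr rfl fun i _ => ?_
  split_ifs <;> simp [eval_finsetSum]

lemma exists_weylVector_of_mem_WP {k : ℕ} {q : ℝ[X]} (hq : q ∈ WP P (k + 1)) :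
    ∃ v, IsWeylVector P (k + 1) v ∧ q = weylPoly P v (k + 1) 0 := by
  cases k with
  | zero =>
    obtain ⟨v, rfl⟩ := (Submodule.mem_span_range_iff_exists_fun ℝ).1 hq
    refine ⟨fun _ => v, fun c hc => by omega, ?_⟩
    simp [weylPoly, pbr, smul_eq_C_mul]
  | succ k =>
    obtain ⟨v, hv, hq⟩ := hq
    let v' : ℕ → Fin r → ℝ := fun i m => if h : i < k + 2 then v (⟨i, h⟩, m) else 0
    have hv' : v = fun ρ : Fin (k + 2) × Fin r => v' ρ.1 ρ.2 := by
      ext ⟨i, m⟩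
      simp [v', i.2]
    refine ⟨v', fun c hc => ?_, ?_⟩
    · rw [weylPoly_succ]
      refine Polynomial.funext fun x => ?_
      have h := congrFun (hv x) ⟨c, by omega⟩
      rw [hv'] at h
      have := vecMul_Lam (P := P) (fun i => v' (i + 1)) (k + 1) x ⟨c, by omega⟩
      simpa using this.symm.trans h
    · refine Polynomial.funext fun x => ?_
      rw [hq x, hv']
      exact vecMul_Lam v' (k + 2) x 0

lemma IsWeylVector.mem_WP {k : ℕ} {v : ℕ → Fin r → ℝ} (hv : IsWeylVector P (k + 2) v) :
    weylPoly P v (k + 2) 0 ∈ WP P (k + 2) := by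
  refine ⟨fun ρ => v ρ.1 ρ.2, fun x => ?_, fun x => ?_⟩
  · ext c
    have := vecMul_Lam (P := P) (fun i => v (i + 1)) (k + 1) x c
    rw [← weylPoly_succ, hv c (by omega)] at this
    simpa using this
  · exact (vecMul_Lam v (k + 2) x 0).symm

end WeylPoly

/-! ### Simultaneous rational-independent expansion of finitely many reals -/

/-- Finitely many reals are integer combinations of `1 / D` and of reals `α l` which together with
`1` are linearly independent over the rationals. -/
lemma exists_independent_expansion {ι : Type*} [Finite ι] (b : ι → ℝ) :
    ∃ (a : ℕ) (α : Fin a → ℝ) (D : ℕ) (z : ι → Fin a → ℤ) (z₀ : ι → ℤ), 0 < D ∧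
      (∀ j, b j = ∑ l, z j l * α l + z₀ j / D) ∧
      ∀ (k : Fin a → ℤ) (k₀ : ℤ), ∑ l, k l * α l + k₀ / D = 0 → k = 0 ∧ k₀ = 0 := by
  classical
  have := Fintype.ofFinite ι
  have h1 : LinearIndepOn ℚ id ({1} : Set ℝ) := by
    simp
  obtain ⟨s, hst, hs1, hspan, hind⟩ := exists_linearIndepOn_extension h1
    (t := insert 1 (Set.range b)) (by simp)
  have hfin : s.Finite := ((Set.finite_range b).insert 1).subset hst
  have hfin' : (s \ {1}).Finite := hfin.sdiff
  let e := hfin'.fintype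
  let eq := (Fintype.equivFin (s \ {1} : Set ℝ)).symm
  set a := Fintype.card (s \ {1} : Set ℝ)
  let γ : Option (Fin a) → ℝ := fun o => o.elim 1 fun l => (eq l : ℝ)
  have hγ : Function.Injective γ := by
    rintro (_ | i) (_ | j) h
    · rfl
    · exact absurd h.symm (eq j).2.2
    · exact absurd h (eq i).2.2
    · simpa [γ, Subtype.coe_inj] using h
  have hrange : Set.range γ = s := by
    ext x
    constructor
    · rintro ⟨_ | i, rfl⟩
      · exact hs1 rfl
      · exact (eq i).2.1
    · intro hx
      by_cases h : x = 1
      · exact ⟨none, h.symm⟩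
      · exact ⟨some (eq.symm ⟨x, hx, h⟩), by simp [γ]⟩
  have hγind : LinearIndependent ℚ γ := by
    have : LinearIndepOn ℚ id (Set.range γ) := by rwa [hrange]
    exact (linearIndepOn_id_range_iff hγ).1 this
  have hb : ∀ j, ∃ q : Option (Fin a) → ℚ, ∑ o, q o • γ o = b j := by
    intro j
    have : b j ∈ Submodule.span ℚ (Set.range γ) := by
      rw [hrange]
      simpa using hspan ⟨b j, by simp, rfl⟩
    exact (Submodule.mem_span_range_iff_exists_fun ℚ).1 this
  choose q hq using hb
  let D : ℕ := ∏ j, ∏ o, (q j o).den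
  have hD : 0 < D := Finset.prod_pos fun j _ => Finset.prod_pos fun o _ => (q j o).den_pos
  have hdvd : ∀ j o, ∃ w : ℤ, (D : ℚ) * q j o = w := by
    intro j o
    obtain ⟨t, ht⟩ : (q j o).den ∣ D :=
      (Finset.dvd_prod_of_mem _ (Finset.mem_univ o)).trans
        (Finset.dvd_prod_of_mem (fun j => ∏ o, (q j o).den) (Finset.mem_univ j))
    refine ⟨t * (q j o).num, ?_⟩
    rw [ht]
    push_cast
    rw [mul_right_comm, Rat.den_mul_eq_num, mul_comm]
  choose w hw using hdvd
  have hD0 : (D : ℝ) ≠ 0 := by positivity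
  have hqw : ∀ j o, ((q j o : ℚ) : ℝ) = w j o / D := by
    intro j o
    have := congrArg (Rat.cast : ℚ → ℝ) (hw j o)
    push_cast at this
    field_simp
    linarith
  refine ⟨a, fun l => γ (some l) / D, D, fun j l => w j (some l), fun j => w j none, hD, ?_, ?_⟩
  · intro j
    rw [← hq j, Fintype.sum_option, add_comm]
    simp only [Rat.smul_def, hqw]
    congr 1
    · exact Finset.sum_congr rfl fun l _ => by ring
    · simp [γ]
  · intro k k₀ h
    have h2 : ∑ o, (o.elim (k₀ : ℚ) fun l => (k l : ℚ)) • γ o = 0 := by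
      rw [Fintype.sum_option]
      simp only [Rat.smul_def, Option.elim_none, Option.elim_some, Rat.cast_intCast]
      have : (D : ℝ) * (∑ l, k l * (γ (some l) / D) + k₀ / D) = 0 := by rw [h, mul_zero]
      rw [mul_add, Finset.mul_sum] at this
      have e1 : ∀ l, (D : ℝ) * (k l * (γ (some l) / D)) = k l * γ (some l) := by
        intro l; field_simp
      simp only [e1] at this
      have e2 : γ none = 1 := rfl
      rw [e2]
      field_simp at this
      linarith
    have h3 := Fintype.linearIndependent_iff.1 hγind _ h2
    refine ⟨funext fun l => ?_, ?_⟩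
    · simpa using h3 (some l)
    · simpa using h3 none

section Expansion

variable {r : ℕ} {P : Fin r → ℝ[X]}

lemma exists_eval_weylPoly_intCast (hP : ∀ k, IsIntegralPoly (P k)) (z : ℕ → Fin r → ℤ)
    (k c : ℕ) (n : ℤ) :
    ∃ w : ℤ, (weylPoly P (fun i m => (z i m : ℝ)) k c).eval (n : ℝ) = w := by
  refine ⟨∑ i ∈ Finset.range k,
    if c ≤ i then ∑ m, z i m * Ring.choose (ieval (P m) n) (i - c + 1) else 0, ?_⟩
  rw [eval_weylPoly hP]
  push_cast
  rfl

lemma isIntegralPoly_weylPoly_intCast (hP : ∀ k, IsIntegralPoly (P k)) (z : ℕ → Fin r → ℤ)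
    (k c : ℕ) : IsIntegralPoly (weylPoly P (fun i m => (z i m : ℝ)) k c) :=
  exists_eval_weylPoly_intCast hP z k c

lemma exists_integer_weylPoly_expansion {ι : Type*} [Finite ι] (v : ι → ℕ → Fin r → ℝ) (k : ℕ) :
    ∃ (a : ℕ) (α : Fin a → ℝ) (D : ℕ) (z : ι → Fin a → ℕ → Fin r → ℤ) (z₀ : ι → ℕ → Fin r → ℤ),
      0 < D ∧
      (∀ j c, weylPoly P (v j) k c =
        ∑ l, C (α l) * weylPoly P (fun i m => (z j l i m : ℝ)) k c
          + C (1 / (D : ℝ)) * weylPoly P (fun i m => (z₀ j i m : ℝ)) k c) ∧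
      ∀ (k : Fin a → ℤ) (k₀ : ℤ), ∑ l, k l * α l + k₀ / D = 0 → k = 0 ∧ k₀ = 0 := by
  obtain ⟨a, α, D, z, z₀, hD, hexp, hind⟩ :=
    exists_independent_expansion fun x : ι × Fin k × Fin r => v x.1 x.2.1 x.2.2
  refine ⟨a, α, D, fun j l i m => if h : i < k then z (j, ⟨i, h⟩, m) l else 0,
    fun j i m => if h : i < k then z₀ (j, ⟨i, h⟩, m) else 0, hD, fun j c => ?_, hind⟩
  simp only [weylPoly, Finset.mul_sum]
  rw [Finset.sum_comm, ← Finset.sum_add_distrib]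
  refine Finset.sum_congr rfl fun i hi => ?_
  have hi := Finset.mem_range.1 hi
  simp only [hi, dite_true]
  split_ifs
  · simp only [Finset.mul_sum]
    rw [Finset.sum_comm, ← Finset.sum_add_distrib]
    refine Finset.sum_congr rfl fun m _ => ?_
    have h := hexp (j, ⟨i, hi⟩, m)
    simp only at h
    rw [h, map_add, map_sum, add_mul, Finset.sum_mul]
    congr 1
    · exact Finset.sum_congr rfl fun l _ => by rw [map_mul]; ring
    · rw [div_eq_mul_one_div, map_mul]; ring
  · simp

lemma eq_of_integer_weylPoly_expansion {a : ℕ} {α : Fin a → ℝ} {D : ℕ} (hD : 0 < D)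
    (hind : ∀ (k : Fin a → ℤ) (k₀ : ℤ), ∑ l, k l * α l + k₀ / D = 0 → k = 0 ∧ k₀ = 0)
    {q : ℝ[X]} (hq : IsIntegralPoly q) {p : Fin a → ℝ[X]} (hp : ∀ l, IsIntegralPoly (p l))
    {p₀ : ℝ[X]} (hp₀ : IsIntegralPoly p₀)
    (h : q = ∑ l, C (α l) * p l + C (1 / (D : ℝ)) * p₀) :
    (∀ l, p l = 0) ∧ p₀ = C (D : ℝ) * q := by
  have hD0 : (D : ℝ) ≠ 0 := by positivity
  have key : ∀ n : ℤ, (fun l => ieval (p l) n) = 0 ∧ ieval p₀ n - D * ieval q n = 0 := by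
    intro n
    refine hind _ _ ?_
    have := congrArg (eval (n : ℝ)) h
    simp only [eval_add, eval_finsetSum, eval_mul, eval_C, ← (hp _).cast_ieval,
      ← hp₀.cast_ieval, ← hq.cast_ieval] at this
    push_cast
    simp only [mul_comm _ (α _)]
    field_simp at this ⊢
    linarith
  refine ⟨fun l => Polynomial.eq_of_eval_intCast_eq fun n => ?_,
    Polynomial.eq_of_eval_intCast_eq fun n => ?_⟩
  · rw [← (hp l).cast_ieval, congrFun (key n).1 l]
    simp
  · rw [← hp₀.cast_ieval, eval_mul, eval_C, ← hq.cast_ieval]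
    have := (key n).2
    rw [sub_eq_zero] at this
    rw [this]
    push_cast
    rfl

lemma isIntegralPoly_zero : IsIntegralPoly 0 := fun _ => ⟨0, by simp⟩

lemma IsWeylVector.of_expansion (hP : ∀ k, IsIntegralPoly (P k)) {k : ℕ} {v : ℕ → Fin r → ℝ}
    (hv : IsWeylVector P k v)
    {a : ℕ} {α : Fin a → ℝ} {D : ℕ} (hD : 0 < D)
    (hind : ∀ (k : Fin a → ℤ) (k₀ : ℤ), ∑ l, k l * α l + k₀ / D = 0 → k = 0 ∧ k₀ = 0)
    {z : Fin a → ℕ → Fin r → ℤ} {z₀ : ℕ → Fin r → ℤ}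
    (h : ∀ c, weylPoly P v k c =
        ∑ l, C (α l) * weylPoly P (fun i m => (z l i m : ℝ)) k c
          + C (1 / (D : ℝ)) * weylPoly P (fun i m => (z₀ i m : ℝ)) k c) :
    (∀ l, IsWeylVector P k fun i m => (z l i m : ℝ)) ∧
      IsWeylVector P k fun i m => (z₀ i m : ℝ) := by
  have key : ∀ c, c + 1 < k → _ := fun c hc =>
    eq_of_integer_weylPoly_expansion hD hind isIntegralPoly_zero
      (fun l => isIntegralPoly_weylPoly_intCast hP (z l) k (c + 1))
      (isIntegralPoly_weylPoly_intCast hP z₀ k (c + 1)) ((hv c hc).symm.trans (h (c + 1)))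
  exact ⟨fun l c hc => (key c hc).1 l, fun c hc => by simpa using (key c hc).2⟩

/-- Recurrence modulo one of all real Weyl polynomials along `R`. -/
def WeylRecurrent (P : Fin r → ℝ[X]) (R : Set ℕ) : Prop :=
  ∀ (k : ℕ) (ι : Type) [Finite ι] (v : ι → ℕ → Fin r → ℝ),
    (∀ j, IsWeylVector P (k + 2) (v j)) → ∀ ε : ℝ, 0 < ε →
      ∃ n ∈ R, ∀ j, ‖(((weylPoly P (v j) (k + 2) 0).eval (n : ℝ) : ℝ) : Torus)‖ < ε

lemma weylRecurrent_of_integral (hP : ∀ k, IsIntegralPoly (P k)) {R : Set ℕ}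
    (H : ∀ (d s : ℕ), 1 ≤ d → 1 ≤ s → ∀ β : Fin s → Torus,
        ∀ (m : ℕ) (q : Fin m → Polynomial ℝ),
          (∀ i, q i ∈ WP P d ∧ IsIntegralPoly (q i)) →
          ∀ ε : ℝ, 0 < ε → ∃ n ∈ R, ∀ (i : Fin m) (j : Fin s),
            ‖(ieval (q i) (n : ℤ)) • β j‖ < ε) : WeylRecurrent P R := by
  intro k ι _ v hv ε hε
  have := Fintype.ofFinite ι
  obtain ⟨a, α, D, z, z₀, hD, hexp, hind⟩ := exists_integer_weylPoly_expansion (P := P) v (k + 2)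
  let γ : Option (Fin a) → ℝ := fun o => o.elim (1 / (D : ℝ)) α
  let Z : ι → Option (Fin a) → ℕ → Fin r → ℤ := fun j o => o.elim (z₀ j) (z j)
  let Q : ι → Option (Fin a) → ℝ[X] := fun j o => weylPoly P (fun i m => (Z j o i m : ℝ)) (k + 2) 0
  have hZ : ∀ j o, IsWeylVector P (k + 2) (fun i m => (Z j o i m : ℝ)) := by
    intro j o
    have := (hv j).of_expansion hP hD hind (hexp j)
    cases o with
    | none => exact this.2
    | some l => exact this.1 l
  have hQi : ∀ j o, IsIntegralPoly (Q j o) := fun j o => isIntegralPoly_weylPoly_intCast hP _ _ _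
  have hsum : ∀ j, weylPoly P (v j) (k + 2) 0 = ∑ o, C (γ o) * Q j o := by
    intro j
    rw [hexp j 0, Fintype.sum_option, add_comm]
    rfl
  let e := Fintype.equivFin (Option (Fin a))
  let e' := Fintype.equivFin (ι × Option (Fin a))
  obtain ⟨n, hn, hnq⟩ := H (k + 2) (Fintype.card (Option (Fin a))) (by omega) Fintype.card_pos
    (fun t => (γ (e.symm t) : Torus)) _ (fun t => Q (e'.symm t).1 (e'.symm t).2)
    (fun t => ⟨(hZ _ _).mem_WP, hQi _ _⟩) (ε / (a + 1)) (by positivity)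
  refine ⟨n, hn, fun j => ?_⟩
  have hterm : ∀ o, ‖((γ o * (Q j o).eval (n : ℝ) : ℝ) : Torus)‖ < ε / (a + 1) := by
    intro o
    have h := hnq (e' (j, o)) (e o)
    simp only [Equiv.symm_apply_apply] at h
    have h2 := (hQi j o).cast_ieval n
    rw [Int.cast_natCast] at h2
    rwa [← AddCircle.coe_zsmul, zsmul_eq_mul, h2, mul_comm] at h
  rw [hsum, eval_finsetSum]
  simp only [eval_mul, eval_C]
  have hcast : ((∑ o, γ o * (Q j o).eval (n : ℝ) : ℝ) : Torus)
      = ∑ o, ((γ o * (Q j o).eval (n : ℝ) : ℝ) : Torus) :=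
    map_sum (QuotientAddGroup.mk' _) _ _
  rw [hcast]
  calc _ ≤ ∑ o, ‖((γ o * (Q j o).eval (n : ℝ) : ℝ) : Torus)‖ := norm_sum_le _ _
    _ < ∑ _o : Option (Fin a), ε / (a + 1) :=
        Finset.sum_lt_sum_of_nonempty Finset.univ_nonempty fun o _ => hterm o
    _ = ε := by
        simp
        field_simp

end Expansion

/-! ### Characters and integer matrices on tori -/

section TorusMatrix

variable {ι κ l : Type*} [Fintype ι]

/-- The homomorphism of tori defined by an integer matrix. -/
def torusMul (A : Matrix κ ι ℤ) : (ι → Torus) →+ (κ → Torus) where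
  toFun x j := ∑ i, A j i • x i
  map_zero' := by ext; simp
  map_add' x y := by ext; simp [Finset.sum_add_distrib]

lemma torusMul_apply (A : Matrix κ ι ℤ) (x : ι → Torus) (j : κ) :
    torusMul A x j = ∑ i, A j i • x i := rfl

lemma continuous_torusMul (A : Matrix κ ι ℤ) : Continuous (torusMul A) := by
  refine continuous_pi fun j => continuous_finsetSum _ fun i _ => ?_
  fun_prop

lemma torusMul_mul [Fintype κ] (A : Matrix l κ ℤ) (B : Matrix κ ι ℤ) (x : ι → Torus) :
    torusMul (A * B) x = torusMul A (torusMul B x) := by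
  ext j
  simp only [torusMul_apply, Matrix.mul_apply, Finset.sum_smul, Finset.smul_sum, mul_smul]
  exact Finset.sum_comm

lemma torusMul_one [DecidableEq ι] (x : ι → Torus) : torusMul (1 : Matrix ι ι ℤ) x = x := by
  ext j
  simp [torusMul_apply, Matrix.one_apply]

/-- The pairing of an integer vector with a point of the torus. -/
def torusDot (w : ι → ℤ) (x : ι → Torus) : Torus := ∑ i, w i • x i

lemma torusDot_add (w : ι → ℤ) (x y : ι → Torus) :
    torusDot w (x + y) = torusDot w x + torusDot w y := by
  simp [torusDot, Finset.sum_add_distrib]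

lemma torusDot_torusMul [Fintype κ] (w : κ → ℤ) (A : Matrix κ ι ℤ) (x : ι → Torus) :
    torusDot w (torusMul A x) = torusDot (Matrix.vecMul w A) x := by
  simp only [torusDot, torusMul_apply, Matrix.vecMul, dotProduct, Finset.sum_smul,
    Finset.smul_sum, mul_smul]
  exact Finset.sum_comm

lemma torusDot_coe (w : ι → ℤ) (x : ι → ℝ) :
    torusDot w (fun i => (x i : Torus)) = ((∑ i, w i * x i : ℝ) : Torus) := by
  have h : ((∑ i, w i * x i : ℝ) : Torus) = ∑ i, ((w i * x i : ℝ) : Torus) :=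
    map_sum (QuotientAddGroup.mk' _) _ _
  rw [h, torusDot]
  exact Finset.sum_congr rfl fun i _ => by rw [← AddCircle.coe_zsmul, zsmul_eq_mul]

lemma mFourier_eq_toCircle (w : ι → ℤ) (x : ι → Torus) :
    UnitAddTorus.mFourier w x = (AddCircle.toCircle (torusDot w x) : ℂ) := by
  have h : ∀ s : Finset ι, ((AddCircle.toCircle (∑ i ∈ s, w i • x i) : Circle) : ℂ)
      = ∏ i ∈ s, fourier (w i) (x i) := by
    classical
    intro s
    induction s using Finset.induction_on with
    | empty => simp
    | insert a s ha ih =>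
      rw [Finset.sum_insert ha, Finset.prod_insert ha, AddCircle.toCircle_add, Circle.coe_mul, ih,
        fourier_apply]
  exact (h Finset.univ).symm

lemma mFourier_apply_add (w : ι → ℤ) (x y : ι → Torus) :
    UnitAddTorus.mFourier w (x + y) = UnitAddTorus.mFourier w x * UnitAddTorus.mFourier w y := by
  simp only [mFourier_eq_toCircle, torusDot_add, AddCircle.toCircle_add, Circle.coe_mul]

lemma mFourier_torusMul [Fintype κ] (w : κ → ℤ) (A : Matrix κ ι ℤ) (x : ι → Torus) :
    UnitAddTorus.mFourier w (torusMul A x) = UnitAddTorus.mFourier (Matrix.vecMul w A) x := by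
  simp only [mFourier_eq_toCircle, torusDot_torusMul]

lemma volume_torus_univ : (volume : Measure (ι → Torus)) Set.univ = 1 := by
  rw [volume_pi, Measure.pi_univ]
  simp

instance isProbabilityMeasure_volume_torus :
    IsProbabilityMeasure (volume : Measure (ι → Torus)) := ⟨volume_torus_univ⟩

lemma integral_mFourier (w : ι → ℤ) [Decidable (w = 0)] :
    ∫ x : ι → Torus, UnitAddTorus.mFourier w x = if w = 0 then 1 else 0 := by
  classical
  split_ifs with h
  · subst h
    simp [UnitAddTorus.mFourier_zero]
  · obtain ⟨i, hi⟩ := Function.ne_iff.1 h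
    have hi' : (w i : ℝ) ≠ 0 := by exact_mod_cast hi
    refine integral_eq_zero_of_add_right_eq_neg
      (g := fun j => ((Pi.single i (1 / (2 * w i)) : ι → ℝ) j : Torus)) fun x => ?_
    have hs : ∑ j, (w j : ℝ) * (Pi.single i (1 / (2 * (w i : ℝ))) : ι → ℝ) j = 1 / 2 := by
      rw [Finset.sum_eq_single i]
      · simp only [Pi.single_eq_same]; field_simp
      · intro j _ hj; simp [hj]
      · simp
    have hx := mFourier_apply_add w x
      (fun j => ((Pi.single i (1 / (2 * w i)) : ι → ℝ) j : Torus))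
    refine hx.trans ?_
    rw [mFourier_eq_toCircle w (fun j => ((Pi.single i (1 / (2 * w i)) : ι → ℝ) j : Torus)),
      torusDot_coe, hs, AddCircle.toCircle_apply_mk]
    have : ((Circle.exp (2 * Real.pi / 1 * (1 / 2)) : Circle) : ℂ) = -1 := by
      rw [show (2 * Real.pi / 1 * (1 / 2) : ℝ) = Real.pi by ring, Circle.coe_exp,
        Complex.exp_pi_mul_I]
    rw [this]
    ring

lemma exists_trigPoly_approx (f : C(ι → Torus, ℂ)) {ε : ℝ} (hε : 0 < ε) :
    ∃ (W : Finset (ι → ℤ)) (c : (ι → ℤ) → ℂ),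
      ∀ x, ‖f x - ∑ w ∈ W, c w * UnitAddTorus.mFourier w x‖ < ε := by
  have h : f ∈ (Submodule.span ℂ
      (Set.range <| UnitAddTorus.mFourier (d := ι))).topologicalClosure := by
    rw [UnitAddTorus.span_mFourier_closure_eq_top]
    trivial
  obtain ⟨g, hg, hfg⟩ := Metric.mem_closure_iff.1 h ε hε
  obtain ⟨c, rfl⟩ := Finsupp.mem_span_range_iff_exists_finsupp.1 hg
  refine ⟨c.support, c, fun x => ?_⟩
  rw [dist_eq_norm] at hfg
  refine lt_of_le_of_lt ?_ hfg
  have := (f - c.sum fun i a => a • UnitAddTorus.mFourier i).norm_coe_le_norm x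
  simpa [Finsupp.sum] using this

end TorusMatrix

/-! ### Measures on tori with nearby Fourier coefficients -/

section FourierClose

variable {ι : Type*} [Fintype ι]

lemma norm_integral_trigPoly_sub_lt (W : Finset (ι → ℤ)) (c : (ι → ℤ) → ℂ)
    {ε : ℝ} (hε : 0 < ε) : ∃ η > 0, ∀ ν ν' : Measure (ι → Torus),
      IsProbabilityMeasure ν → IsProbabilityMeasure ν' →
      (∀ w ∈ W, ‖∫ x, UnitAddTorus.mFourier w x ∂ν' - ∫ x, UnitAddTorus.mFourier w x ∂ν‖ < η) →
      ‖∫ x, (∑ w ∈ W, c w * UnitAddTorus.mFourier w x) ∂ν'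
        - ∫ x, (∑ w ∈ W, c w * UnitAddTorus.mFourier w x) ∂ν‖ < ε := by
  have hC : 0 < ∑ w ∈ W, ‖c w‖ + 1 :=
    add_pos_of_nonneg_of_pos (Finset.sum_nonneg fun _ _ => norm_nonneg _) one_pos
  refine ⟨ε / (∑ w ∈ W, ‖c w‖ + 1), by positivity, fun ν ν' _ _ h => ?_⟩
  have hint : ∀ (μ : Measure (ι → Torus)) [IsProbabilityMeasure μ] (w : ι → ℤ),
      Integrable (fun x => c w * UnitAddTorus.mFourier w x) μ := fun μ _ w =>
    Continuous.integrable_of_hasCompactSupport (by fun_prop) (HasCompactSupport.of_compactSpace _)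
  rw [integral_finsetSum _ fun w _ => hint ν' w, integral_finsetSum _ fun w _ => hint ν w,
    ← Finset.sum_sub_distrib]
  calc _ ≤ ∑ w ∈ W, ‖c w‖ * (ε / (∑ w ∈ W, ‖c w‖ + 1)) := by
        refine (norm_sum_le _ _).trans (Finset.sum_le_sum fun w hw => ?_)
        rw [integral_const_mul, integral_const_mul, ← mul_sub, norm_mul]
        exact mul_le_mul_of_nonneg_left (h w hw).le (norm_nonneg _)
    _ = (∑ w ∈ W, ‖c w‖) * (ε / (∑ w ∈ W, ‖c w‖ + 1)) := by rw [Finset.sum_mul]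
    _ < ε := by
        rw [mul_div_assoc', div_lt_iff₀ hC]
        nlinarith

lemma exists_fourier_nhds_lt_measure_open (ν : Measure (ι → Torus)) [IsProbabilityMeasure ν]
    {V : Set (ι → Torus)} (hV : IsOpen V) {c : ℝ} (hc : c < ν.real V) :
    ∃ (W : Finset (ι → ℤ)) (η : ℝ), 0 < η ∧ ∀ ν' : Measure (ι → Torus), IsProbabilityMeasure ν' →
      (∀ w ∈ W, ‖∫ x, UnitAddTorus.mFourier w x ∂ν' - ∫ x, UnitAddTorus.mFourier w x ∂ν‖ < η) →
      c < ν'.real V := by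
  obtain hc0 | hc0 := lt_or_ge c 0
  · exact ⟨∅, 1, one_pos, fun ν' _ _ => hc0.trans_le measureReal_nonneg⟩
  have hc' : ENNReal.ofReal c < ν V := by
    rw [ENNReal.ofReal_lt_iff_lt_toReal hc0 (measure_ne_top _ _)]; exact hc
  obtain ⟨K, hKV, hK, hcK⟩ := hV.exists_lt_isCompact hc'
  have hcK' : c < ν.real K := by
    rwa [ENNReal.ofReal_lt_iff_lt_toReal hc0 (measure_ne_top _ _)] at hcK
  obtain ⟨f, hf1, hf0, -, hf⟩ := exists_continuous_one_zero_of_isCompact hK hV.isClosed_compl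
    (Set.disjoint_compl_right_iff_subset.2 hKV)
  have hε : 0 < (ν.real K - c) / 4 := by linarith
  set ε := (ν.real K - c) / 4 with hεdef
  obtain ⟨W, co, hW⟩ := exists_trigPoly_approx
    (⟨fun x => (f x : ℂ), by fun_prop⟩ : C(ι → Torus, ℂ)) hε
  obtain ⟨η, hη, H⟩ := norm_integral_trigPoly_sub_lt W co hε
  refine ⟨W, η, hη, fun ν' hν' h => ?_⟩
  have hint : ∀ (μ : Measure (ι → Torus)) [IsProbabilityMeasure μ] (g : (ι → Torus) → ℂ),
      Continuous g → Integrable g μ := fun μ _ g hg =>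
    hg.integrable_of_hasCompactSupport (HasCompactSupport.of_compactSpace _)
  have hintf : ∀ (μ : Measure (ι → Torus)) [IsProbabilityMeasure μ],
      Integrable (fun x => f x) μ := fun μ _ =>
    f.continuous.integrable_of_hasCompactSupport (HasCompactSupport.of_compactSpace _)
  have key : ∀ (μ : Measure (ι → Torus)) [IsProbabilityMeasure μ],
      ‖((∫ x, f x ∂μ : ℝ) : ℂ) - ∫ x, (∑ w ∈ W, co w * UnitAddTorus.mFourier w x) ∂μ‖ ≤ ε := by
    intro μ _
    rw [← integral_complex_ofReal, ← integral_sub]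
    · refine (norm_integral_le_of_norm_le_const (C := ε) (.of_forall fun x => (hW x).le)).trans ?_
      simp
    · exact hint μ _ (by fun_prop)
    · exact hint μ _ (by fun_prop)
  have h1 := key ν
  have h2 := key ν'
  have h3 := H ν ν' inferInstance hν' h
  have h4 : ‖((∫ x, f x ∂ν' : ℝ) : ℂ) - ((∫ x, f x ∂ν : ℝ) : ℂ)‖ < 3 * ε := by
    set a := ∫ x, (∑ w ∈ W, co w * UnitAddTorus.mFourier w x) ∂ν
    set a' := ∫ x, (∑ w ∈ W, co w * UnitAddTorus.mFourier w x) ∂ν'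
    calc _ = ‖((((∫ x, f x ∂ν' : ℝ) : ℂ)) - a') + (a' - a) - ((((∫ x, f x ∂ν : ℝ) : ℂ)) - a)‖ := by
          congr 1; ring
      _ ≤ _ := norm_sub_le _ _
      _ ≤ _ + _ := add_le_add_left (norm_add_le _ _) _
      _ < 3 * ε := by linarith
  rw [← Complex.ofReal_sub, Complex.norm_real, Real.norm_eq_abs, abs_lt] at h4
  have h5 : ν.real K ≤ ∫ x, f x ∂ν := by
    rw [← integral_indicator_one hK.measurableSet]
    refine integral_mono ((integrable_const _).indicator hK.measurableSet) (hintf ν) fun x => ?_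
    by_cases hx : x ∈ K
    · simp [hx, hf1 hx]
    · simp [hx, (hf x).1]
  have h6 : ∫ x, f x ∂ν' ≤ ν'.real V := by
    rw [← integral_indicator_one hV.measurableSet]
    refine integral_mono (hintf ν') ((integrable_const _).indicator hV.measurableSet) fun x => ?_
    by_cases hx : x ∈ V
    · simp [hx, (hf x).2]
    · simp [hx, hf0 hx]
  linarith

/-- The block of coordinates with first index `o`. -/
def torusBlock {O κ : Type*} (o : O) (y : O × κ → Torus) : κ → Torus := fun i => y (o, i)

lemma continuous_torusBlock {O κ : Type*} (o : O) : Continuous (torusBlock (κ := κ) o) := by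
  unfold torusBlock; fun_prop

lemma exists_fourier_nhds_measure_pos {O κ : Type*} [Fintype O] [Fintype κ]
    (ν : Measure (O × κ → Torus)) [IsProbabilityMeasure ν]
    {S : Set (κ → Torus)} (hS : MeasurableSet S)
    (hpos : 0 < ν {y | ∀ o, torusBlock o y ∈ S}) :
    ∃ (W : Finset (O × κ → ℤ)) (η : ℝ), 0 < η ∧ ∀ ν' : Measure (O × κ → Torus),
      IsProbabilityMeasure ν' → (∀ o, ν'.map (torusBlock o) = volume) →
      (∀ w ∈ W, ‖∫ x, UnitAddTorus.mFourier w x ∂ν' - ∫ x, UnitAddTorus.mFourier w x ∂ν‖ < η) →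
      0 < ν' {y | ∀ o, torusBlock o y ∈ S} := by
  set c := ν.real {y | ∀ o, torusBlock o y ∈ S} with hcdef
  have hc : 0 < c := ENNReal.toReal_pos hpos.ne' (measure_ne_top _ _)
  have hδ : 0 < c / (2 * (Fintype.card O + 1)) := by positivity
  set δ := c / (2 * (Fintype.card O + 1)) with hδdef
  obtain ⟨V, hSV, hV, -, hVS⟩ := hS.exists_isOpen_sdiff_lt (μ := volume) (measure_ne_top _ _)
    (ENNReal.ofReal_pos.2 hδ).ne'
  have hVo : IsOpen {y : O × κ → Torus | ∀ o, torusBlock o y ∈ V} := by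
    rw [Set.ofPred_forall]
    exact isOpen_iInter_of_finite fun o => hV.preimage (continuous_torusBlock o)
  have hle : c ≤ ν.real {y | ∀ o, torusBlock o y ∈ V} :=
    measureReal_mono (fun y hy o => hSV (hy o)) (measure_ne_top _ _)
  obtain ⟨W, η, hη, H⟩ := exists_fourier_nhds_lt_measure_open ν hVo (c := c / 2) (by linarith)
  refine ⟨W, η, hη, fun ν' hν' hm hw => ?_⟩
  have h1 := H ν' hν' hw
  have hsub : {y : O × κ → Torus | ∀ o, torusBlock o y ∈ V} ⊆
      {y | ∀ o, torusBlock o y ∈ S} ∪ ⋃ o, torusBlock o ⁻¹' (V \ S) := by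
    intro y hy
    by_cases h : ∀ o, torusBlock o y ∈ S
    · exact Or.inl h
    · push Not at h
      obtain ⟨o, ho⟩ := h
      exact Or.inr (Set.mem_iUnion.2 ⟨o, hy o, ho⟩)
  have h2 : ν'.real (⋃ o, torusBlock o ⁻¹' (V \ S)) ≤ Fintype.card O * δ := by
    refine (measureReal_iUnion_fintype_le _).trans ?_
    calc _ ≤ ∑ _o : O, δ := Finset.sum_le_sum fun o _ => ?_
      _ = _ := by simp
    have : ν' (torusBlock o ⁻¹' (V \ S)) = volume (V \ S) := by
      rw [← hm o, Measure.map_apply (continuous_torusBlock o).measurable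
        (hV.measurableSet.diff hS)]
    rw [measureReal_def, this]
    exact ENNReal.toReal_le_of_le_ofReal hδ.le hVS.le
  have h3 : ν'.real {y | ∀ o, torusBlock o y ∈ V} ≤
      ν'.real {y | ∀ o, torusBlock o y ∈ S} + ν'.real (⋃ o, torusBlock o ⁻¹' (V \ S)) :=
    (measureReal_mono hsub (measure_ne_top _ _)).trans (measureReal_union_le _ _)
  have h4 : Fintype.card O * δ < c / 2 := by
    rw [hδdef, mul_div_assoc', div_lt_iff₀ (by positivity)]
    nlinarith
  have h5 : 0 < ν'.real {y | ∀ o, torusBlock o y ∈ S} := by linarith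
  exact (ENNReal.toReal_pos_iff.1 h5).1

end FourierClose

/-! ### Positive recurrence of affine families close to a limiting family -/

section AffineRecurrence

variable {O κ J : Type*} [Fintype O] [Fintype κ] [Fintype J]

open scoped Topology symmDiff

lemma prod_measure_forall_add_mem_pos
    (L : O → (J → Torus) →+ (κ → Torus)) (hL : ∀ o, Continuous (L o))
    {S : Set (κ → Torus)} (hS : MeasurableSet S) (hpos : 0 < volume S) :
    0 < ((volume : Measure (κ → Torus)).prod (volume : Measure (J → Torus)))
      {p | ∀ o, p.1 + L o p.2 ∈ S} := by
  have hmeas : MeasurableSet {p : (κ → Torus) × (J → Torus) | ∀ o, p.1 + L o p.2 ∈ S} := by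
    rw [Set.ofPred_forall]
    refine MeasurableSet.iInter fun o => ?_
    have : Continuous fun p : (κ → Torus) × (J → Torus) => p.1 + L o p.2 := by
      have := hL o
      fun_prop
    exact this.measurable hS
  have hlim : ∀ o, Tendsto (fun y => volume (((fun x => x + L o y) ⁻¹' S) ∆ S)) (𝓝 0) (𝓝 0) := by
    intro o
    have hc : Continuous fun p : (J → Torus) × (κ → Torus) => p.2 + L o p.1 := by
      have := hL o
      fun_prop
    have h := tendsto_measure_symmDiff_preimage_nhds_zero (μ := (volume : Measure (κ → Torus)))
      (ν := (volume : Measure (κ → Torus))) (l := 𝓝 (0 : J → Torus))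
      (f := fun y => (ContinuousMap.curry ⟨_, hc⟩) y)
      (g := (ContinuousMap.curry ⟨_, hc⟩) 0) (s := S)
      ((ContinuousMap.curry ⟨_, hc⟩).continuous.tendsto 0)
      (.of_forall fun y => measurePreserving_add_right volume (L o y))
      (measurePreserving_add_right volume (L o 0)) hS.nullMeasurableSet (measure_ne_top _ _)
    have h0 : (fun x : κ → Torus => x + L o 0) = id := by ext; simp
    have h1 : Tendsto (fun y => volume (((fun x => x + L o y) ⁻¹' S) ∆
        ((fun x => x + L o 0) ⁻¹' S))) (𝓝 0) (𝓝 0) := h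
    simpa [h0] using h1
  have hsum : Tendsto (fun y => ∑ o, volume (((fun x => x + L o y) ⁻¹' S) ∆ S)) (𝓝 0) (𝓝 0) := by
    simpa using tendsto_finsetSum Finset.univ fun o _ => hlim o
  have hev : ∀ᶠ y in 𝓝 (0 : J → Torus), 0 < volume {x : κ → Torus | ∀ o, x + L o y ∈ S} := by
    filter_upwards [hsum.eventually (gt_mem_nhds hpos)] with y hy
    by_contra h0
    have hsub : S ⊆ {x : κ → Torus | ∀ o, x + L o y ∈ S} ∪
        ⋃ o, (((fun x => x + L o y) ⁻¹' S) ∆ S) := by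
      intro x hx
      by_cases h : ∀ o, x + L o y ∈ S
      · exact Or.inl h
      · push Not at h
        obtain ⟨o, ho⟩ := h
        exact Or.inr (Set.mem_iUnion.2 ⟨o, Or.inr ⟨hx, ho⟩⟩)
    have h1 := (measure_mono hsub).trans (measure_union_le (μ := volume) _ _)
    rw [nonpos_iff_eq_zero.1 (not_lt.1 h0), zero_add] at h1
    exact absurd (h1.trans (measure_iUnion_fintype_le _ _)) (not_le.2 hy)
  rw [Measure.prod_apply_symm hmeas, pos_iff_ne_zero]
  intro h0
  rw [lintegral_eq_zero_iff (measurable_measure_prodMk_right hmeas)] at h0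
  have hz : volume {y : J → Torus | ¬ volume {x : κ → Torus | ∀ o, x + L o y ∈ S} = 0} = 0 := h0
  have hp := Measure.measure_pos_of_mem_nhds (volume : Measure (J → Torus))
    (hev.mono fun y hy => show ¬ volume {x : κ → Torus | ∀ o, x + L o y ∈ S} = 0 from hy.ne')
  exact hp.ne' hz

/-- The matrix repeating a vector in every block. -/
def diagBlocks (O κ : Type*) [DecidableEq κ] : Matrix (O × κ) κ ℤ :=
  fun p i => if p.2 = i then 1 else 0

lemma torusMul_diagBlocks {O : Type*} [DecidableEq κ] (x : κ → Torus) (p : O × κ) :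
    torusMul (diagBlocks O κ) x p = x p.2 := by
  simp [torusMul_apply, diagBlocks]

lemma exists_affineRecurrence [DecidableEq κ] (G : Matrix (O × κ) J ℤ)
    {S : Set (κ → Torus)} (hS : MeasurableSet S) (hpos : 0 < volume S) :
    ∃ (W : Finset (O × κ → ℤ)) (η : ℝ), 0 < η ∧
      ∀ (B : Matrix (O × κ) κ ℤ) (d : O × κ → Torus),
        (∀ o, (volume : Measure (κ → Torus)).map
          (fun x => torusBlock o (torusMul B x + d)) = volume) →
        (∀ w ∈ W, (Matrix.vecMul w B = 0 ↔
            Matrix.vecMul w (diagBlocks O κ) = 0 ∧ Matrix.vecMul w G = 0) ∧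
          (Matrix.vecMul w B = 0 → ‖torusDot w d‖ < η)) →
        0 < volume {x | ∀ o, torusBlock o (torusMul B x + d) ∈ S} := by
  classical
  set Ψ : (κ → Torus) × (J → Torus) → (O × κ → Torus) :=
    fun p => torusMul (diagBlocks O κ) p.1 + torusMul G p.2 with hΨ
  have hΨc : Continuous Ψ := by
    have h1 := continuous_torusMul (diagBlocks O κ)
    have h2 := continuous_torusMul G
    fun_prop
  set ν := ((volume : Measure (κ → Torus)).prod (volume : Measure (J → Torus))).map Ψ with hν
  have : IsProbabilityMeasure ν := Measure.isProbabilityMeasure_map hΨc.measurable.aemeasurable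
  have hblockmeas : MeasurableSet {y : O × κ → Torus | ∀ o, torusBlock o y ∈ S} := by
    rw [Set.ofPred_forall]
    exact MeasurableSet.iInter fun o => (continuous_torusBlock o).measurable hS
  have hνpos : 0 < ν {y | ∀ o, torusBlock o y ∈ S} := by
    rw [hν, Measure.map_apply hΨc.measurable hblockmeas]
    let L : O → (J → Torus) →+ (κ → Torus) := fun o => torusMul fun i => G (o, i)
    convert prod_measure_forall_add_mem_pos L (fun o => continuous_torusMul _) hS hpos using 2
    ext p
    have : ∀ o, torusBlock o (Ψ p) = p.1 + L o p.2 := by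
      intro o
      ext i
      change torusMul (diagBlocks O κ) p.1 (o, i) + torusMul G p.2 (o, i) = p.1 i + _
      rw [torusMul_diagBlocks]
      rfl
    simp [this]
  have hνF : ∀ w, ∫ y, UnitAddTorus.mFourier w y ∂ν =
      if Matrix.vecMul w (diagBlocks O κ) = 0 ∧ Matrix.vecMul w G = 0 then 1 else 0 := by
    intro w
    rw [hν, integral_map hΨc.measurable.aemeasurable (by fun_prop)]
    simp only [hΨ, mFourier_apply_add, mFourier_torusMul]
    rw [integral_prod_mul (fun x => UnitAddTorus.mFourier (Matrix.vecMul w (diagBlocks O κ)) x)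
      (fun y => UnitAddTorus.mFourier (Matrix.vecMul w G) y), integral_mFourier, integral_mFourier]
    split_ifs <;> simp_all
  obtain ⟨W, η, hη, H⟩ := exists_fourier_nhds_measure_pos ν hS hνpos
  have hcirc : ∀ᶠ t in 𝓝 (0 : Torus), ‖((AddCircle.toCircle t : Circle) : ℂ) - 1‖ < η := by
    have hc : Continuous fun t : Torus => ‖((AddCircle.toCircle t : Circle) : ℂ) - 1‖ := by
      have := AddCircle.continuous_toCircle (T := (1 : ℝ))
      fun_prop
    have := hc.tendsto 0
    simp only [AddCircle.toCircle_zero, Circle.coe_one, sub_self, norm_zero] at this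
    exact this.eventually (gt_mem_nhds hη)
  obtain ⟨δ, hδ, hδη⟩ := Metric.eventually_nhds_iff.1 hcirc
  refine ⟨W, δ, hδ, fun B d hm hw => ?_⟩
  set Φ : (κ → Torus) → (O × κ → Torus) := fun x => torusMul B x + d with hΦ
  have hΦc : Continuous Φ := by
    have h1 := continuous_torusMul B
    fun_prop
  have hprob : IsProbabilityMeasure ((volume : Measure (κ → Torus)).map Φ) :=
    Measure.isProbabilityMeasure_map hΦc.measurable.aemeasurable
  have := H ((volume : Measure (κ → Torus)).map Φ) hprob (fun o => ?_) (fun w hwW => ?_)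
  · rwa [Measure.map_apply hΦc.measurable hblockmeas] at this
  · rw [Measure.map_map (continuous_torusBlock o).measurable hΦc.measurable]
    exact hm o
  · rw [hνF, integral_map hΦc.measurable.aemeasurable (by fun_prop)]
    simp only [hΦ, mFourier_apply_add, mFourier_torusMul]
    rw [integral_mul_const, integral_mFourier]
    obtain ⟨h1, h2⟩ := hw w hwW
    by_cases h : Matrix.vecMul w B = 0
    · rw [if_pos h, if_pos (h1.1 h), one_mul, mFourier_eq_toCircle]
      exact hδη (by simpa using h2 h)
    · rw [if_neg h, if_neg (fun h' => h (h1.2 h'))]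
      simpa using hη

end AffineRecurrence

/-! ### Roots and integer powers of unipotent endomorphisms -/

section Unipotent

lemma exists_polynomial_root_one_add_X (M : ℕ) (hM : 0 < M) (K : ℕ) :
    ∃ e g : ℝ[X], (1 + X * e) ^ M = 1 + X + X ^ (K + 1) * g := by
  induction K with
  | zero =>
    exact ⟨0, -1, by simp⟩
  | succ K ih =>
    obtain ⟨e, g, h⟩ := ih
    set a : ℝ := g.eval 0 / M with ha
    obtain ⟨k, hk⟩ := Polynomial.powAddExpansion (1 + X * e) (-(X ^ (K + 1) * C a)) M
    have hM0 : (M : ℝ) ≠ 0 := by positivity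
    obtain ⟨g', hg'⟩ : X ∣ g - (M : ℝ[X]) * (1 + X * e) ^ (M - 1) * C a := by
      rw [X_dvd_iff, coeff_zero_eq_eval_zero]
      simp [ha]
      field_simp
      simp
    refine ⟨e - X ^ K * C a, g' + k * X ^ K * C a ^ 2, ?_⟩
    have h1 : 1 + X * (e - X ^ K * C a) = 1 + X * e + -(X ^ (K + 1) * C a) := by ring
    rw [h1, hk, h]
    linear_combination X ^ (K + 1) * hg'

variable {V : Type*} [AddCommGroup V] [Module ℝ V]

lemma exists_root_one_add_nilpotent (n : Module.End ℝ V) (M : ℕ) (hM : 0 < M) (K : ℕ)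
    (hn : n ^ (K + 1) = 0) :
    ∃ e : Module.End ℝ V, Commute n e ∧ (1 + n * e) ^ M = 1 + n := by
  obtain ⟨p, g, h⟩ := exists_polynomial_root_one_add_X M hM K
  refine ⟨aeval n p, ?_, ?_⟩
  · simpa using Commute.map (Commute.all (X : ℝ[X]) p) (aeval n)
  · have := congrArg (aeval n) h
    simpa [hn] using this

/-- The powers of `1 + n` with an integer exponent, for `n` with `n ^ k = 0`. -/
def unipotentPow (n : Module.End ℝ V) (k : ℕ) (K : ℤ) : Module.End ℝ V :=
  ∑ j ∈ Finset.range k, Ring.choose K j • n ^ j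

lemma unipotentPow_zero (n : Module.End ℝ V) (k : ℕ) : unipotentPow n (k + 1) 0 = 1 := by
  simp [unipotentPow, Finset.sum_range_succ', Ring.choose_zero_succ]

lemma unipotentPow_add_one (n : Module.End ℝ V) (k : ℕ) (hn : n ^ (k + 1) = 0) (K : ℤ) :
    unipotentPow n (k + 1) (K + 1) = (1 + n) * unipotentPow n (k + 1) K := by
  have h1 : n * unipotentPow n (k + 1) K =
      ∑ j ∈ Finset.range k, Ring.choose K j • n ^ (j + 1) := by
    rw [unipotentPow, Finset.mul_sum, Finset.sum_range_succ]
    simp only [mul_smul_comm, ← pow_succ', hn, smul_zero, add_zero]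
  rw [add_mul, one_mul, h1]
  simp only [unipotentPow, Finset.sum_range_succ', Ring.choose_succ_succ, add_smul,
    Finset.sum_add_distrib, Ring.choose_zero_right]
  abel

lemma unipotentPow_add_natCast (n : Module.End ℝ V) (k : ℕ) (hn : n ^ (k + 1) = 0) (K : ℤ)
    (M : ℕ) : unipotentPow n (k + 1) (K + M) = (1 + n) ^ M * unipotentPow n (k + 1) K := by
  induction M with
  | zero => simp
  | succ M ih =>
    rw [Nat.cast_succ, ← add_assoc, unipotentPow_add_one n k hn, ih, pow_succ', mul_assoc]

end Unipotent

/-! ### Iterates of a Weyl system on a fibre over the finite factor -/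

section WeylIterates

/-- The covering homomorphism of the torus. -/
def torusCoe {ι : Type*} : (ι → ℝ) →+ (ι → Torus) where
  toFun x i := (x i : Torus)
  map_zero' := by ext; simp
  map_add' x y := by ext; simp

lemma torusCoe_surjective {ι : Type*} : Function.Surjective (torusCoe (ι := ι)) := by
  intro x
  choose y hy using fun i => QuotientAddGroup.mk_surjective (x i)
  exact ⟨y, funext hy⟩

lemma torusMul_torusCoe {ι κ : Type*} [Fintype ι] (A : Matrix κ ι ℤ) (x : ι → ℝ) :
    torusMul A (torusCoe x) = torusCoe ((A.map (Int.cast : ℤ → ℝ)).mulVec x) := by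
  ext j
  exact torusDot_coe (A j) x

variable {N : ℕ} {F : Type}

lemma exists_weylT_pow_fiber [AddCommGroup F] [Finite F]
    (a : (Fin N → Torus) × F) (U : ((Fin N → Torus) × F) ≃+ ((Fin N → Torus) × F))
    (A : Matrix (Fin N) (Fin N) ℤ)
    (hU : ∀ x : Fin N → Torus, U (x, (0 : F)) = (torusMul A x, 0)) (g : F) :
    ∃ M : ℕ, 0 < M ∧ ∃ c, ∀ x, (weylT a U ^ M) (x, g) = (torusMul (A ^ M) x + c, g) := by
  set τ : F → F := fun g => a.2 + (U (0, g)).2 with hτ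
  have hT : ∀ x g, weylT a U (x, g) = (torusMul A x + (a.1 + (U (0, g)).1), τ g) := by
    intro x g
    have h : U (x, g) = U (x, 0) + U (0, g) := by rw [← map_add]; simp
    change a + U (x, g) = _
    rw [h, hU]
    ext1
    · simp; abel
    · simp [hτ]
  have hpow : ∀ j : ℕ, ∃ c, ∀ x, (weylT a U ^ j) (x, g) = (torusMul (A ^ j) x + c, τ^[j] g) := by
    intro j
    induction j with
    | zero => exact ⟨0, fun x => by simp [torusMul_one]⟩
    | succ j ih =>
      obtain ⟨c, hc⟩ := ih
      refine ⟨torusMul A c + (a.1 + (U (0, τ^[j] g)).1), fun x => ?_⟩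
      rw [pow_succ', Equiv.Perm.mul_apply, hc, hT, Function.iterate_succ_apply', pow_succ',
        torusMul_mul, map_add, add_assoc]
  have hsurj : Function.Surjective τ := by
    intro g
    obtain ⟨⟨x, g'⟩, h⟩ := (weylT a U).surjective (0, g)
    exact ⟨g', by rw [hT] at h; exact congrArg Prod.snd h⟩
  obtain ⟨M, hM, hg⟩ := (Finite.injective_iff_surjective.2 hsurj).mem_periodicPts g
  obtain ⟨c, hc⟩ := hpow M
  exact ⟨M, hM, c, fun x => by rw [hc, hg]⟩

lemma exists_unipotentPow_fiber (T : Equiv.Perm ((Fin N → Torus) × F)) (g : F)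
    (B : Matrix (Fin N) (Fin N) ℤ) (hB : (B - 1) ^ N = 0) (c : Fin N → Torus) {M : ℕ} (hM : 0 < M)
    (hT : ∀ x, (T ^ M) (x, g) = (torusMul B x + c, g)) :
    ∃ n : Module.End ℝ ((Fin N → ℝ) × ℝ), n ^ (N + 1) = 0 ∧ (∀ v, (n v).2 = 0) ∧
      ∀ K : ℤ, (M : ℤ) ∣ K → ∀ x : Fin N → ℝ,
        (T ^ K) (torusCoe x, g) = (torusCoe (unipotentPow n (N + 1) K (x, 1)).1, g) := by
  obtain ⟨c, rfl⟩ := torusCoe_surjective c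
  set D : Matrix (Fin N) (Fin N) ℝ := (B - 1).map (Int.cast : ℤ → ℝ) with hD
  have hDN : D ^ N = 0 := by
    have := congrArg (Int.castRingHom ℝ).mapMatrix hB
    rw [map_pow, map_zero] at this
    exact this
  set n₀ : Module.End ℝ ((Fin N → ℝ) × ℝ) :=
    LinearMap.prod (LinearMap.coprod (Matrix.toLin' D) (LinearMap.toSpanSingleton ℝ _ c)) 0
    with hn₀
  have hn₀a : ∀ v, n₀ v = (D.mulVec v.1 + v.2 • c, 0) := by
    intro v
    simp [hn₀]
  have hpow : ∀ (k : ℕ) v, (n₀ ^ (k + 1)) v = ((D ^ k).mulVec (D.mulVec v.1 + v.2 • c), 0) := by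
    intro k v
    induction k with
    | zero => simp [hn₀a]
    | succ k ih =>
      rw [pow_succ' n₀, Module.End.mul_apply, ih, hn₀a, pow_succ' D, ← Matrix.mulVec_mulVec]
      simp
  have hn₀N : n₀ ^ (N + 1) = 0 := by
    refine LinearMap.ext fun v => ?_
    rw [hpow, hDN, Matrix.zero_mulVec]
    rfl
  obtain ⟨e, hcomm, he⟩ := exists_root_one_add_nilpotent n₀ M hM N hn₀N
  set n := n₀ * e with hn
  have hnN : n ^ (N + 1) = 0 := by rw [hn, hcomm.mul_pow, hn₀N, zero_mul]
  have hn2 : ∀ v, (n v).2 = 0 := fun v => by rw [hn, Module.End.mul_apply, hn₀a]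
  refine ⟨n, hnN, hn2, ?_⟩
  have hE2 : ∀ K x, (unipotentPow n (N + 1) K (x, 1)).2 = 1 := by
    intro K x
    simp only [unipotentPow, Finset.sum_range_succ', LinearMap.add_apply, LinearMap.sum_apply,
      Prod.snd_add, Prod.snd_sum, pow_succ', LinearMap.smul_apply, Module.End.mul_apply,
      Prod.smul_snd, hn2]
    simp
  have hstep : ∀ y : (Fin N → ℝ) × ℝ, y.2 = 1 →
      (T ^ M) (torusCoe y.1, g) = (torusCoe (((1 + n) ^ M) y).1, g) := by
    intro y hy
    rw [hT, he, torusMul_torusCoe, ← map_add]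
    congr 2
    have : (B.map (Int.cast : ℤ → ℝ)) = 1 + D := by
      rw [hD, Matrix.map_sub _ (fun a b => Int.cast_sub a b),
        Matrix.map_one _ Int.cast_zero Int.cast_one]
      simp
    rw [this, LinearMap.add_apply, hn₀a, Matrix.add_mulVec]
    simp [hy, add_assoc]
  have hadd : ∀ (K : ℤ) (x : Fin N → ℝ),
      (T ^ (M : ℤ)) (torusCoe (unipotentPow n (N + 1) K (x, 1)).1, g) =
        (torusCoe (unipotentPow n (N + 1) (K + M) (x, 1)).1, g) := by
    intro K x
    rw [unipotentPow_add_natCast n N hnN, Module.End.mul_apply, zpow_natCast]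
    exact hstep _ (hE2 K x)
  rintro K ⟨K, rfl⟩ x
  induction K using Int.induction_on with
  | zero => simp [unipotentPow_zero]
  | succ i ih =>
    rw [mul_add, mul_one, add_comm _ (M : ℤ), zpow_add, Equiv.Perm.mul_apply, ih, hadd,
      add_comm (M : ℤ)]
  | pred i ih =>
    apply (T ^ (M : ℤ)).injective
    rw [← Equiv.Perm.mul_apply, ← zpow_add, hadd]
    have : (M : ℤ) + M * (-i - 1) = M * -i := by ring
    rw [this, ih, add_comm _ (M : ℤ), this]

end WeylIterates

section

variable {r : ℕ} {P : Fin r → ℝ[X]}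

/-- The coefficient vector of the Weyl polynomial `t * P m`. -/
def singleWeylVector (m : Fin r) (t : ℝ) (i : ℕ) (m' : Fin r) : ℝ :=
  if i = 0 ∧ m' = m then t else 0

lemma isWeylVector_single (m : Fin r) (t : ℝ) (k : ℕ) :
    IsWeylVector P k (singleWeylVector m t) := by
  intro c _
  refine Finset.sum_eq_zero fun i _ => ?_
  split_ifs with h
  · refine Finset.sum_eq_zero fun m' _ => ?_
    have : i ≠ 0 := by omega
    simp [singleWeylVector, this]
  · rfl

lemma weylPoly_single (m : Fin r) (t : ℝ) (k : ℕ) :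
    weylPoly P (singleWeylVector m t) (k + 1) 0 = C t * P m := by
  simp [weylPoly, Finset.sum_range_succ', singleWeylVector, pbr, apply_ite C]

lemma dvd_of_norm_div_lt {K : ℤ} {M : ℕ} (hM : 0 < M)
    (h : ‖((K / M : ℝ) : Torus)‖ < 1 / M) : (M : ℤ) ∣ K := by
  rw [UnitAddCircle.norm_eq] at h
  have hM0 : (0 : ℝ) < M := by positivity
  refine ⟨round ((K : ℝ) / M), ?_⟩
  have h1 : |(K : ℝ) - M * round ((K : ℝ) / M)| < 1 := by
    have : (K : ℝ) - M * round ((K : ℝ) / M) = M * ((K : ℝ) / M - round ((K : ℝ) / M)) := by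
      field_simp
    rw [this, abs_mul, abs_of_pos hM0]
    rw [lt_div_iff₀ hM0] at h
    linarith
  have h2 : |K - M * round ((K : ℝ) / M)| < 1 := by exact_mod_cast h1
  have := Int.abs_lt_one_iff.1 h2
  linarith

lemma norm_sqrt_two_mul_pos {K : ℤ} (hK : K ≠ 0) : 0 < ‖((√2 * K : ℝ) : Torus)‖ := by
  rw [norm_pos_iff]
  intro h
  obtain ⟨n, hn⟩ := (AddCircle.coe_eq_zero_iff (1 : ℝ)).1 h
  have := (irrational_sqrt_two.mul_intCast hK)
  exact this.ne_int n (by rw [← hn]; simp)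

lemma WeylRecurrent.exists_notMem (hP : ∀ k, IsIntegralPoly (P k)) {R : Set ℕ}
    (hR : WeylRecurrent P R) (h0 : ∀ n ∈ R, ∃ m, (P m).eval (n : ℝ) ≠ 0)
    {k : ℕ} {ι : Type} [Finite ι] {v : ι → ℕ → Fin r → ℝ}
    (hv : ∀ j, IsWeylVector P (k + 2) (v j)) {ε : ℝ} (hε : 0 < ε) {M : ℕ} (hM : 0 < M)
    (Z : Finset ℕ) :
    ∃ n ∈ R, n ∉ Z ∧ (∀ m, (M : ℤ) ∣ ieval (P m) n) ∧
      ∀ j, ‖(((weylPoly P (v j) (k + 2) 0).eval (n : ℝ) : ℝ) : Torus)‖ < ε := by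
  classical
  have hcast : ∀ (m : Fin r) (n : ℕ), (P m).eval (n : ℝ) = (ieval (P m) n : ℤ) := fun m n => by
    rw [(hP m).cast_ieval]; simp
  have hZ : ∀ n : ℕ, ∃ δ > 0, n ∈ R → ∃ m, δ ≤ ‖((√2 * (P m).eval (n : ℝ) : ℝ) : Torus)‖ := by
    intro n
    by_cases hn : n ∈ R
    · obtain ⟨m, hm⟩ := h0 n hn
      rw [hcast] at hm
      exact ⟨_, norm_sqrt_two_mul_pos (by exact_mod_cast hm), fun _ => ⟨m, by rw [hcast]⟩⟩
    · exact ⟨1, one_pos, fun h => absurd h hn⟩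
  choose δ hδ hδZ using hZ
  obtain ⟨δ₀, hδ₀, hδ₀Z⟩ : ∃ δ₀ > 0, ∀ n ∈ Z, δ₀ ≤ δ n := by
    obtain rfl | hne := Z.eq_empty_or_nonempty
    · exact ⟨1, one_pos, by simp⟩
    · obtain ⟨n, -, hn⟩ := Z.exists_min_image δ hne
      exact ⟨δ n, hδ n, hn⟩
  have hM' : (0 : ℝ) < 1 / M := by positivity
  obtain ⟨n, hnR, hn⟩ := hR k (ι ⊕ Fin r ⊕ Fin r)
    (Sum.elim v (Sum.elim (fun m => singleWeylVector m (1 / M)) fun m => singleWeylVector m √2))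
    (by
      rintro (j | m | m)
      · exact hv j
      · exact isWeylVector_single _ _ _
      · exact isWeylVector_single _ _ _) (min ε (min (1 / M) δ₀)) (by positivity)
  refine ⟨n, hnR, fun hnZ => ?_, fun m => ?_, fun j => (hn (Sum.inl j)).trans_le (min_le_left _ _)⟩
  · obtain ⟨m, hm⟩ := hδZ n hnR
    have h := hn (Sum.inr (Sum.inr m))
    simp only [Sum.elim_inr, weylPoly_single, eval_mul, eval_C] at h
    have := hδ₀Z n hnZ
    have h2 := h.trans_le ((min_le_right _ _).trans (min_le_right _ _))
    linarith
  · have h := hn (Sum.inr (Sum.inl m))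
    simp only [Sum.elim_inr, Sum.elim_inl, weylPoly_single, eval_mul, eval_C] at h
    refine dvd_of_norm_div_lt hM ?_
    have h2 := h.trans_le ((min_le_right _ _).trans (min_le_left _ _))
    rwa [hcast, mul_comm, mul_one_div] at h2

end

/-! ### The Weyl polynomials of a fibre and their recurrence -/

section FiberRecurrence

variable {r : ℕ} {P : Fin r → ℝ[X]} {N : ℕ}

lemma unipotentPow_apply {n : Module.End ℝ ((Fin N → ℝ) × ℝ)} (hn : n ^ (N + 1) = 0) (K : ℤ)
    (ξ : (Fin N → ℝ) × ℝ) :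
    unipotentPow n (N + 1) K ξ =
      ξ + ∑ j ∈ Finset.range (N + 2), Ring.choose K (j + 1) • (n ^ (j + 1)) ξ := by
  have hn' : n ^ (N + 2) = 0 := by rw [pow_succ, hn, zero_mul]
  rw [Finset.sum_range_succ, Finset.sum_range_succ, hn, hn', unipotentPow, Finset.sum_range_succ']
  simp [LinearMap.sum_apply, add_comm]

/-- The coefficients of the frequency `w` paired with the displacement of `ξ`. -/
def fiberVector (n : Module.End ℝ ((Fin N → ℝ) × ℝ)) (w : Option (Fin r) × Fin N → ℤ)
    (ξ : (Fin N → ℝ) × ℝ) (j : ℕ) (m : Fin r) : ℝ :=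
  ∑ i, w (some m, i) * ((n ^ (j + 1)) ξ).1 i

/-- The displacement polynomial of the frequency `w`, linear in both arguments. -/
def fiberPoly (P : Fin r → ℝ[X]) (n : Module.End ℝ ((Fin N → ℝ) × ℝ)) :
    (Option (Fin r) × Fin N → ℤ) →+ ((Fin N → ℝ) × ℝ) →ₗ[ℝ] ℝ[X] where
  toFun w :=
    { toFun := fun ξ => weylPoly P (fiberVector n w ξ) (N + 2) 0
      map_add' := fun ξ ξ' => by
        simp [weylPoly, fiberVector, mul_add, add_mul, Finset.sum_add_distrib]
      map_smul' := fun c ξ => by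
        simp only [weylPoly, fiberVector, zero_le, if_true, smul_eq_C_mul, Finset.mul_sum,
          RingHom.id_apply, map_smul, Prod.smul_fst, Pi.smul_apply, smul_eq_mul]
        refine Finset.sum_congr rfl fun i _ => Finset.sum_congr rfl fun m _ => ?_
        rw [← mul_assoc, ← map_mul, Finset.mul_sum]
        congr 2
        exact Finset.sum_congr rfl fun i _ => by ring }
  map_zero' := by refine LinearMap.ext fun ξ => ?_; simp [weylPoly, fiberVector]
  map_add' w w' := by
    refine LinearMap.ext fun ξ => ?_
    simp [weylPoly, fiberVector, add_mul, Finset.sum_add_distrib]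

lemma fiberPoly_apply (n : Module.End ℝ ((Fin N → ℝ) × ℝ)) (w : Option (Fin r) × Fin N → ℤ)
    (ξ : (Fin N → ℝ) × ℝ) :
    fiberPoly P n w ξ = weylPoly P (fiberVector n w ξ) (N + 2) 0 := rfl

lemma weylPoly_fiberVector {n : Module.End ℝ ((Fin N → ℝ) × ℝ)} (hn : n ^ (N + 1) = 0)
    (w : Option (Fin r) × Fin N → ℤ) (c : ℕ) (ξ : (Fin N → ℝ) × ℝ) :
    weylPoly P (fiberVector n w ξ) (N + 2) c = fiberPoly P n w ((n ^ c) ξ) := by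
  induction c generalizing ξ with
  | zero => simp [fiberPoly_apply]
  | succ c ih =>
    have h : (fun i => fiberVector n w ξ (i + 1)) = fiberVector n w (n ξ) := by
      ext i m
      simp only [fiberVector]
      rw [pow_succ n (i + 1), Module.End.mul_apply]
    have hn' : n ^ (N + 1 + 1) = 0 := by rw [pow_succ, hn, zero_mul]
    rw [weylPoly_succ, h, pow_succ, Module.End.mul_apply, ← ih, weylPoly, weylPoly,
      Finset.sum_range_succ _ (N + 1)]
    simp [fiberVector, hn']

lemma eval_fiberPoly (hP : ∀ k, IsIntegralPoly (P k)) {n : Module.End ℝ ((Fin N → ℝ) × ℝ)}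
    (hn : n ^ (N + 1) = 0) (w : Option (Fin r) × Fin N → ℤ) (ξ : (Fin N → ℝ) × ℝ) (x : ℤ) :
    (fiberPoly P n w ξ).eval (x : ℝ) = ∑ m, ∑ i, w (some m, i) *
      ((unipotentPow n (N + 1) (ieval (P m) x) ξ).1 i - ξ.1 i) := by
  rw [fiberPoly_apply, eval_weylPoly hP]
  simp only [zero_le, if_true]
  rw [Finset.sum_comm]
  refine Finset.sum_congr rfl fun m _ => ?_
  simp only [fiberVector, Finset.sum_mul]
  rw [Finset.sum_comm]
  refine Finset.sum_congr rfl fun i _ => ?_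
  rw [unipotentPow_apply hn]
  simp only [Prod.fst_add, Prod.fst_sum, Prod.smul_fst, Pi.add_apply, Finset.sum_apply,
    Pi.smul_apply, add_sub_cancel_left, Finset.mul_sum, tsub_zero]
  simp only [zsmul_eq_mul]
  exact Finset.sum_congr rfl fun j _ => by ring

lemma isWeylVector_fiberVector {n : Module.End ℝ ((Fin N → ℝ) × ℝ)} (hn : n ^ (N + 1) = 0)
    (hn2 : ∀ v, (n v).2 = 0) {w : Option (Fin r) × Fin N → ℤ}
    (hw : ∀ i, fiberPoly P n w (Pi.single i 1, 0) = 0) (ξ : (Fin N → ℝ) × ℝ) :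
    IsWeylVector P (N + 2) (fiberVector n w ξ) := by
  intro c _
  rw [weylPoly_fiberVector hn]
  have h0 : (fiberPoly P n w) ∘ₗ LinearMap.inl ℝ (Fin N → ℝ) ℝ = 0 := by
    refine LinearMap.pi_ext' fun i => LinearMap.ext_ring ?_
    simpa using hw i
  have h : (n ^ (c + 1)) ξ = LinearMap.inl ℝ (Fin N → ℝ) ℝ ((n ^ (c + 1)) ξ).1 := by
    refine Prod.ext rfl ?_
    rw [pow_succ', Module.End.mul_apply, hn2]
    rfl
  rw [h]
  exact LinearMap.congr_fun h0 _

lemma exists_torusMul_fiber {F : Type} {T : Equiv.Perm ((Fin N → Torus) × F)} {g : F}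
    {n : Module.End ℝ ((Fin N → ℝ) × ℝ)} {K : ℤ}
    (hT : ∀ x : Fin N → ℝ,
        (T ^ K) (torusCoe x, g) = (torusCoe (unipotentPow n (N + 1) K (x, 1)).1, g)) :
    ∃ B : Matrix (Fin N) (Fin N) ℤ,
      (∀ j i, (B j i : ℝ) = (unipotentPow n (N + 1) K (Pi.single i 1, 0)).1 j) ∧
      ∀ x, (T ^ K) (x, g) = (torusMul B x + torusCoe (unipotentPow n (N + 1) K (0, 1)).1, g) := by
  set E := unipotentPow n (N + 1) K with hE
  have hsplit : ∀ x : Fin N → ℝ, E (x, 1) = E (x, 0) + E (0, 1) := by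
    intro x
    rw [← map_add]; simp
  have hint : ∀ j i, ∃ z : ℤ, (z : ℝ) = (E (Pi.single i 1, 0)).1 j := by
    intro j i
    have h0 : torusCoe (Pi.single i (1 : ℝ) : Fin N → ℝ) = torusCoe 0 := by
      ext j
      by_cases h : j = i
      · subst h
        simp [torusCoe]
      · simp [torusCoe, h]
    have h1 := hT (Pi.single i 1)
    rw [h0, hT, hsplit (Pi.single i 1)] at h1
    have h2 := congrFun (congrArg Prod.fst h1) j
    simp only [Prod.fst_add, map_add] at h2
    have h4 : (((E (Pi.single i 1, 0)).1 j : ℝ) : Torus) = 0 :=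
      add_eq_right.1 (h2.symm : torusCoe (E (Pi.single i 1, 0)).1 j + _ = _)
    obtain ⟨z, hz⟩ := (AddCircle.coe_eq_zero_iff (1 : ℝ)).1 h4
    exact ⟨z, by simpa using hz⟩
  choose B hB using hint
  refine ⟨Matrix.of B, hB, fun x => ?_⟩
  obtain ⟨x, rfl⟩ := torusCoe_surjective x
  rw [hT, hsplit, torusMul_torusCoe, Prod.fst_add, map_add]
  set f : (Fin N → ℝ) →ₗ[ℝ] (Fin N → ℝ) :=
    LinearMap.fst ℝ _ _ ∘ₗ E ∘ₗ LinearMap.inl ℝ (Fin N → ℝ) ℝ with hf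
  have hBf : Matrix.map (Matrix.of B) (Int.cast : ℤ → ℝ) = LinearMap.toMatrix' f := by
    ext j i
    simp [LinearMap.toMatrix'_apply, hB, hf]
  have : (E (x, 0)).1 = (Matrix.map (Matrix.of B) (Int.cast : ℤ → ℝ)).mulVec x := by
    rw [hBf, LinearMap.toMatrix'_mulVec]
    rfl
  rw [this]

end FiberRecurrence

section ReturnTimes

lemma exists_matrix_ker {ι M : Type*} [Fintype ι] [AddCommGroup M] [Module.IsTorsionFree ℤ M]
    (Λ : (ι → ℤ) →+ M) :
    ∃ (t : ℕ) (G : Matrix ι (Fin t) ℤ), ∀ w, Matrix.vecMul w G = 0 ↔ Λ w = 0 := by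
  classical
  set f := Λ.toIntLinearMap.rangeRestrict with hf
  have : Module.Free ℤ (LinearMap.range Λ.toIntLinearMap) := inferInstance
  set b := Module.finBasis ℤ (LinearMap.range Λ.toIntLinearMap) with hb
  set φ := b.equivFun.toLinearMap ∘ₗ f with hφ
  refine ⟨_, (LinearMap.toMatrix' φ).transpose, fun w => ?_⟩
  rw [Matrix.vecMul_transpose, LinearMap.toMatrix'_mulVec, hφ, LinearMap.comp_apply,
    LinearEquiv.coe_coe, LinearEquiv.map_eq_zero_iff, hf]
  exact Subtype.ext_iff

variable {r : ℕ} {P : Fin r → ℝ[X]} {N : ℕ}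

lemma exists_return_fiber (hP : ∀ k, IsIntegralPoly (P k)) (hz : ∀ k, (P k).eval 0 = 0)
    {R : Set ℕ} (hR : WeylRecurrent P R) (h0 : ∀ n ∈ R, ∃ m, (P m).eval (n : ℝ) ≠ 0)
    {F : Type} {T : Equiv.Perm ((Fin N → Torus) × F)} {g : F}
    {n : Module.End ℝ ((Fin N → ℝ) × ℝ)} (hn : n ^ (N + 1) = 0) (hn2 : ∀ v, (n v).2 = 0)
    {M : ℕ} (hM : 0 < M)
    (hT : ∀ K : ℤ, (M : ℤ) ∣ K → ∀ x : Fin N → ℝ,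
        (T ^ K) (torusCoe x, g) = (torusCoe (unipotentPow n (N + 1) K (x, 1)).1, g))
    {S : Set (Fin N → Torus)} (hS : MeasurableSet S) (hpos : 0 < volume S) :
    ∃ x ∈ R, 0 < volume
      {y | y ∈ S ∧ ∀ m, ((T ^ ieval (P m) (x : ℤ)) (y, g)).1 ∈ S ∧
        ((T ^ ieval (P m) (x : ℤ)) (y, g)).2 = g} := by
  classical
  have hz' : ∀ m, ieval (P m) 0 = 0 := fun m => ieval_eq_of_eval (by simpa using hz m)
  set e : Fin N → (Fin N → ℝ) × ℝ := fun i => (Pi.single i 1, 0) with he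
  obtain ⟨t, G, hG⟩ := exists_matrix_ker
    ({ toFun := fun w i => fiberPoly P n w (e i)
       map_zero' := by ext1; simp
       map_add' := fun w w' => by ext1; simp } :
      (Option (Fin r) × Fin N → ℤ) →+ (Fin N → ℝ[X]))
  have hG' : ∀ w, Matrix.vecMul w G = 0 ↔ ∀ i, fiberPoly P n w (e i) = 0 := fun w => by
    rw [hG, funext_iff]; rfl
  obtain ⟨W, η, hη, H⟩ := exists_affineRecurrence G hS hpos
  set W' := {w : W // ∀ i, fiberPoly P n w.1 (e i) = 0}
  set ρ : (Option (Fin r) × Fin N → ℤ) → Fin N → ℝ[X] := fun w i =>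
    C ((Matrix.vecMul w (diagBlocks (Option (Fin r)) (Fin N)) i : ℤ) : ℝ)
      + fiberPoly P n w (e i) with hρ
  have hρ0 : ∀ w i, ρ w i = 0 ↔ Matrix.vecMul w (diagBlocks (Option (Fin r)) (Fin N)) i = 0 ∧
      fiberPoly P n w (e i) = 0 := by
    intro w i
    constructor
    · intro h
      have h1 : (fiberPoly P n w (e i)).eval ((0 : ℤ) : ℝ) = 0 := by
        rw [eval_fiberPoly hP hn]
        simp [hz', unipotentPow_zero]
      have h2 := congrArg (eval ((0 : ℤ) : ℝ)) h
      rw [hρ, eval_add, eval_C, h1, add_zero, eval_zero, Int.cast_eq_zero] at h2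
      refine ⟨h2, ?_⟩
      simpa [hρ, h2] using h
    · rintro ⟨h1, h2⟩
      simp [hρ, h1, h2]
  have hZfin : Set.Finite {x : ℕ | ∃ w ∈ W, ∃ i, ρ w i ≠ 0 ∧ (ρ w i).eval (x : ℝ) = 0} := by
    have : {x : ℕ | ∃ w ∈ W, ∃ i, ρ w i ≠ 0 ∧ (ρ w i).eval (x : ℝ) = 0} ⊆
        (Nat.cast : ℕ → ℝ) ⁻¹' (⋃ w ∈ W, ⋃ i, {y | y ∈ (ρ w i).roots}) := by
      rintro x ⟨w, hw, i, h1, h2⟩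
      simp only [Set.mem_preimage, Set.mem_iUnion]
      exact ⟨w, hw, i, (mem_roots h1).2 h2⟩
    refine Set.Finite.subset (Set.Finite.preimage Nat.cast_injective.injOn ?_) this
    exact W.finite_toSet.biUnion fun w _ => Set.finite_iUnion fun i =>
      (ρ w i).roots.toFinset.finite_toSet.subset fun y hy => by simpa using hy
  obtain ⟨x, hxR, hxZ, hxM, hxq⟩ := hR.exists_notMem hP h0 (k := N) (ι := W')
    (v := fun w => fiberVector n w.1.1 (0, 1))
    (fun w => isWeylVector_fiberVector hn hn2 w.2 _) hη hM hZfin.toFinset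
  rw [Set.Finite.mem_toFinset] at hxZ
  refine ⟨x, hxR, ?_⟩
  choose B hB hBT using fun m => exists_torusMul_fiber (hT _ (hxM m))
  set d : Fin r → Fin N → ℝ := fun m => (unipotentPow n (N + 1) (ieval (P m) x) (0, 1)).1 with hd
  set BB : Matrix (Option (Fin r) × Fin N) (Fin N) ℤ := fun p i =>
    p.1.elim (if p.2 = i then 1 else 0) fun m => B m p.2 i with hBB
  set dd : Option (Fin r) × Fin N → ℝ := fun p => p.1.elim 0 fun m => d m p.2 with hdd
  have hnone : ∀ y, torusBlock none (torusMul BB y + torusCoe dd) = y := by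
    intro y
    ext j
    change torusMul BB y (none, j) + torusCoe dd (none, j) = y j
    rw [torusMul_apply]
    simp [hBB, torusCoe, hdd]
  have hsome : ∀ m y, torusBlock (some m) (torusMul BB y + torusCoe dd)
      = torusMul (B m) y + torusCoe (d m) := fun m y => rfl
  have hvec : ∀ w i, ((Matrix.vecMul w BB i : ℤ) : ℝ) = (ρ w i).eval (x : ℝ) := by
    intro w i
    have h1 := eval_fiberPoly hP hn w (e i) x
    rw [Int.cast_natCast] at h1
    rw [hρ, eval_add, eval_C, h1]
    simp only [Matrix.vecMul, dotProduct, hBB, Fintype.sum_prod_type, Fintype.sum_option,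
      Option.elim_none, Option.elim_some, diagBlocks, Int.cast_add, Int.cast_sum, Int.cast_mul, hB]
    rw [add_assoc, ← Finset.sum_add_distrib]
    congr 1
    refine Finset.sum_congr rfl fun m _ => ?_
    rw [← Finset.sum_add_distrib]
    refine Finset.sum_congr rfl fun j _ => ?_
    simp only [he, Pi.single_apply]
    push_cast
    ring
  have hfin := H BB (torusCoe dd) (fun o => ?_) (fun w hw => ⟨?_, fun h => ?_⟩)
  · refine hfin.trans_le (measure_mono fun y hy => ⟨?_, fun m => ?_⟩)
    · simpa only [hnone] using hy none
    · have := hy (some m)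
      rw [hsome] at this
      rw [hBT]
      exact ⟨this, rfl⟩
  · cases o with
    | none => simp only [hnone]; exact Measure.map_id
    | some m =>
      simp only [hsome]
      have hsurj : Function.Surjective (torusMul (B m)) := by
        intro y
        obtain ⟨u, hu⟩ := torusCoe_surjective (y + torusCoe (d m))
        have h1 := hT (-ieval (P m) x) ((hxM m).neg_right) u
        set z := torusCoe (unipotentPow n (N + 1) (-ieval (P m) x) (u, 1)).1
        have h2 := hBT m z
        rw [← h1, ← Equiv.Perm.mul_apply, ← zpow_add, add_neg_cancel, zpow_zero,
          Equiv.Perm.one_apply, hu] at h2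
        exact ⟨z, (add_right_cancel (congrArg Prod.fst h2)).symm⟩
      have hmp : MeasurePreserving (torusMul (B m)) volume volume :=
        AddMonoidHom.measurePreserving (continuous_torusMul _) hsurj (by simp)
      exact ((measurePreserving_add_right volume (torusCoe (d m))).comp hmp).map_eq
  · rw [hG']
    constructor
    · intro h
      have h1 : ∀ i, ρ w i = 0 := by
        intro i
        by_contra h1
        refine hxZ ⟨w, hw, i, h1, ?_⟩
        rw [← hvec, h]
        simp
      exact ⟨funext fun i => ((hρ0 w i).1 (h1 i)).1, fun i => ((hρ0 w i).1 (h1 i)).2⟩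
    · rintro ⟨h1, h2⟩
      ext i
      have := hvec w i
      rw [(hρ0 w i).2 ⟨congrFun h1 i, h2 i⟩, eval_zero] at this
      exact_mod_cast this
  · have h1 : ∀ i, ρ w i = 0 := by
      intro i
      by_contra h1
      refine hxZ ⟨w, hw, i, h1, ?_⟩
      rw [← hvec, h]
      simp
    have h2 := hxq ⟨⟨w, hw⟩, fun i => ((hρ0 w i).1 (h1 i)).2⟩
    have h3 : torusDot w (torusCoe dd) = ((∑ p, w p * dd p : ℝ) : Torus) := torusDot_coe w dd
    rw [h3]
    convert h2 using 3
    have h4 := eval_fiberPoly hP hn w (0, 1) x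
    rw [Int.cast_natCast, fiberPoly_apply] at h4
    rw [h4]
    simp [Fintype.sum_prod_type, Fintype.sum_option, hdd, hd]

end ReturnTimes

section WeylMeasure

variable {N : ℕ} {F : Type} [Fintype F] [MeasurableSpace F]

lemma weylMeasure_prod_singleton [MeasurableSingletonClass F] (S : Set (Fin N → Torus)) (g : F) :
    weylMeasure N F (S ×ˢ {g}) = volume S * (Fintype.card F : ENNReal)⁻¹ := by
  rw [weylMeasure, Measure.prod_prod]
  simp

instance isProbabilityMeasure_weylMeasure [Nonempty F] [MeasurableSingletonClass F] :
    IsProbabilityMeasure (weylMeasure N F) := by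
  have : IsProbabilityMeasure ((Fintype.card F : ENNReal)⁻¹ • (Measure.count : Measure F)) := ⟨by
    simp [ENNReal.inv_mul_cancel]⟩
  unfold weylMeasure
  infer_instance

lemma weylMeasure_pos_iff [MeasurableSingletonClass F] {S : Set ((Fin N → Torus) × F)} :
    0 < weylMeasure N F S ↔ ∃ g, 0 < volume {x | (x, g) ∈ S} := by
  have hc : (Fintype.card F : ENNReal)⁻¹ ≠ 0 := by simp
  constructor
  · intro h
    by_contra! h0
    have hsub : S ⊆ ⋃ g, {x | (x, g) ∈ S} ×ˢ {g} := fun x hx =>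
      Set.mem_iUnion.2 ⟨x.2, hx, rfl⟩
    refine h.ne' (measure_mono_null hsub (measure_iUnion_null fun g => ?_))
    rw [weylMeasure_prod_singleton, nonpos_iff_eq_zero.1 (h0 g), zero_mul]
  · rintro ⟨g, hg⟩
    have hsub : {x | (x, g) ∈ S} ×ˢ {g} ⊆ S := by
      rintro ⟨x, g'⟩ ⟨h1, h2⟩
      obtain rfl : g' = g := h2
      exact h1
    refine lt_of_lt_of_le ?_ (measure_mono hsub)
    rw [weylMeasure_prod_singleton]
    exact ENNReal.mul_pos hg.ne' hc

lemma weylMeasure_pos_of_isOpen [TopologicalSpace F] [MeasurableSingletonClass F]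
    {V : Set ((Fin N → Torus) × F)} (hV : IsOpen V) (hne : V.Nonempty) :
    0 < weylMeasure N F V := by
  obtain ⟨⟨x, g⟩, hx⟩ := hne
  refine weylMeasure_pos_iff.2 ⟨g, ?_⟩
  exact (hV.preimage (by fun_prop : Continuous fun x => (x, g))).measure_pos _ ⟨x, hx⟩

variable {r : ℕ} {P : Fin r → ℝ[X]}

lemma WeylRecurrent.measurable_recurrence [AddCommGroup F] [TopologicalSpace F]
    [MeasurableSingletonClass F]
    (hP : ∀ k, IsIntegralPoly (P k)) (hz : ∀ k, (P k).eval 0 = 0)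
    {R : Set ℕ} (hR : WeylRecurrent P R)
    {a : (Fin N → Torus) × F} {U : ((Fin N → Torus) × F) ≃+ ((Fin N → Torus) × F)}
    {A : Matrix (Fin N) (Fin N) ℤ} (h : IsWeylSystemWith a U A)
    {S : Set ((Fin N → Torus) × F)} (hS : MeasurableSet S) (hpos : 0 < weylMeasure N F S) :
    ∃ n ∈ R, 0 < weylMeasure N F
      (S ∩ ⋂ k : Fin r, (weylT a U ^ (ieval (P k) (n : ℤ))) ⁻¹' S) := by
  by_cases h0 : ∀ n ∈ R, ∃ m, (P m).eval (n : ℝ) ≠ 0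
  · obtain ⟨hA, -, hU, -⟩ := h
    obtain ⟨g, hg⟩ := weylMeasure_pos_iff.1 hpos
    obtain ⟨M, hM, c, hc⟩ := exists_weylT_pow_fiber a U A hU g
    have hB : (A ^ M - 1) ^ N = 0 := by
      have hcomm : Commute (A - 1) (∑ i ∈ Finset.range M, A ^ i) :=
        Commute.sum_right _ _ _ fun i _ =>
          ((Commute.refl A).sub_left (Commute.one_left A)).pow_right i
      rw [← mul_geom_sum, hcomm.mul_pow, hA, zero_mul]
    obtain ⟨n, hn, hn2, hT⟩ := exists_unipotentPow_fiber (weylT a U) g (A ^ M) hB c hM hc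
    have hSg : MeasurableSet {x | (x, g) ∈ S} := measurable_prodMk_right hS
    obtain ⟨x, hxR, hx⟩ := exists_return_fiber hP hz hR h0 hn hn2 hM hT hSg hg
    refine ⟨x, hxR, weylMeasure_pos_iff.2 ⟨g, hx.trans_le (measure_mono ?_)⟩⟩
    rintro y ⟨hy, hy'⟩
    refine ⟨hy, Set.mem_iInter.2 fun m => ?_⟩
    obtain ⟨h1, h2⟩ := hy' m
    have h3 : (weylT a U ^ ieval (P m) (x : ℤ)) (y, g) =
        (((weylT a U ^ ieval (P m) (x : ℤ)) (y, g)).1, g) := Prod.ext rfl h2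
    show _ ∈ S
    rw [h3]
    exact h1
  · push Not at h0
    obtain ⟨n, hn, h0⟩ := h0
    refine ⟨n, hn, ?_⟩
    have h1 : ∀ m, ieval (P m) (n : ℤ) = 0 := fun m => ieval_eq_of_eval (by simpa using h0 m)
    refine hpos.trans_le (measure_mono (Set.subset_inter subset_rfl
      (Set.subset_iInter fun m => ?_)))
    rw [h1 m, zpow_zero]
    exact subset_rfl

end WeylMeasure

section FourierRigidity

variable {ι : Type*} [Fintype ι]

lemma orthonormal_mFourier : Orthonormal ℂ fun w : ι → ℤ =>
    ContinuousMap.toLp 2 (volume : Measure (ι → Torus)) ℂ (UnitAddTorus.mFourier w) := by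
  classical
  rw [orthonormal_iff_ite]
  intro v w
  have h : ∀ x : ι → Torus,
      UnitAddTorus.mFourier w x * (starRingEnd ℂ) (UnitAddTorus.mFourier v x)
        = UnitAddTorus.mFourier (w + -v) x := fun x => by
    rw [UnitAddTorus.mFourier_add, UnitAddTorus.mFourier_neg]
  rw [ContinuousMap.inner_toLp]
  simp_rw [h]
  rw [integral_mFourier]
  simp only [← sub_eq_add_neg, sub_eq_zero, eq_comm]

lemma sum_sq_norm_setIntegral_mFourier_le {E : Set (ι → Torus)} (hE : MeasurableSet E)
    (W : Finset (ι → ℤ)) : ∑ w ∈ W, ‖∫ x in E, UnitAddTorus.mFourier w x‖ ^ 2 ≤ 1 := by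
  have hfin : (volume : Measure (ι → Torus)) E ≠ ⊤ := measure_ne_top _ _
  have h := orthonormal_mFourier.sum_inner_products_le
    (indicatorConstLp 2 hE hfin (1 : ℂ)) (s := W)
  refine (Finset.sum_le_sum fun w _ => ?_).trans (h.trans ?_)
  · rw [norm_inner_symm, L2.inner_indicatorConstLp_one]
    refine le_of_eq ?_
    congr 2
    exact integral_congr_ae
      (EventuallyEq.symm (ae_restrict_of_ae (ContinuousMap.coeFn_toLp _ _)))
  · have h1 : volume.real E ≤ 1 := measureReal_le_one
    rw [norm_indicatorConstLp (by norm_num) (by norm_num)]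
    simp only [norm_one, one_mul]
    exact pow_le_one₀ (by positivity) (Real.rpow_le_one measureReal_nonneg h1 (by norm_num))

lemma setIntegral_mFourier_eq_zero_of_injective {E : Set (ι → Torus)} (hE : MeasurableSet E)
    {w : ι → ℤ} {v : ℕ → ι → ℤ} (hv : Function.Injective v)
    (h : ∀ i, ‖∫ x in E, UnitAddTorus.mFourier (v i) x‖ = ‖∫ x in E, UnitAddTorus.mFourier w x‖) :
    ∫ x in E, UnitAddTorus.mFourier w x = 0 := by
  classical
  by_contra h0
  have hpos : 0 < ‖∫ x in E, UnitAddTorus.mFourier w x‖ ^ 2 := by positivity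
  obtain ⟨n, hn⟩ := exists_nat_gt (1 / ‖∫ x in E, UnitAddTorus.mFourier w x‖ ^ 2)
  have h1 := sum_sq_norm_setIntegral_mFourier_le hE ((Finset.range n).image v)
  rw [Finset.sum_image hv.injOn] at h1
  simp only [h, Finset.sum_const, Finset.card_range, nsmul_eq_mul] at h1
  rw [div_lt_iff₀ hpos] at hn
  linarith

lemma measure_eq_zero_or_compl_of_setIntegral_mFourier {E : Set (ι → Torus)} (hE : MeasurableSet E)
    (h : ∀ w ≠ 0, ∫ x in E, UnitAddTorus.mFourier w x = 0) :
    volume E = 0 ∨ volume Eᶜ = 0 := by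
  classical
  by_cases h0 : volume E = 0
  · exact Or.inl h0
  right
  have hfin : volume E ≠ ⊤ := measure_ne_top _ _
  set ν : Measure (ι → Torus) := (volume E)⁻¹ • volume.restrict E with hν
  have hprob : IsProbabilityMeasure ν := ⟨by simp [hν, ENNReal.inv_mul_cancel h0 hfin]⟩
  have hint : ∀ w, ∫ x, UnitAddTorus.mFourier w x ∂ν = ∫ x, UnitAddTorus.mFourier w x := by
    intro w
    rw [integral_mFourier]
    split_ifs with hw
    · subst hw
      simp [UnitAddTorus.mFourier_zero]
    · rw [hν, integral_smul_measure, h w hw, smul_zero]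
  have hopen : ∀ V : Set (ι → Torus), IsOpen V → volume V ≤ ν V := by
    intro V hV
    have hreal : volume.real V ≤ ν.real V := by
      refine le_of_forall_lt fun c hc => ?_
      obtain ⟨W, η, hη, hW⟩ := exists_fourier_nhds_lt_measure_open volume hV hc
      exact hW ν hprob fun w _ => by rw [hint, sub_self, norm_zero]; exact hη
    rwa [measureReal_def, measureReal_def,
      ENNReal.toReal_le_toReal (measure_ne_top _ _) (measure_ne_top _ _)] at hreal
  have hz : ν Eᶜ = 0 := by simp [hν, Measure.restrict_apply hE.compl]
  refine le_antisymm ?_ zero_le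
  rw [← hz, Set.measure_eq_iInf_isOpen Eᶜ ν]
  exact le_iInf₂ fun V hV => le_iInf fun hVo => (measure_mono hV).trans (hopen V hVo)

end FourierRigidity

section UnipotentOrbit

variable {N : ℕ}

lemma injective_vecMul_pow {A : Matrix (Fin N) (Fin N) ℤ} (hA : (A - 1) ^ N = 0)
    {w : Fin N → ℤ} (hw : Matrix.vecMul w (A - 1) ≠ 0) :
    Function.Injective fun i : ℕ => Matrix.vecMul w (A ^ i) := by
  classical
  have hex : ∃ t, Matrix.vecMul w ((A - 1) ^ t) = 0 := ⟨N, by rw [hA, Matrix.vecMul_zero]⟩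
  obtain ⟨t, ht, ht1⟩ : ∃ t, Matrix.vecMul w ((A - 1) ^ (t + 1)) ≠ 0 ∧
      Matrix.vecMul w ((A - 1) ^ (t + 2)) = 0 := by
    have hs := Nat.find_spec hex
    have hm := fun m => Nat.find_min hex (m := m)
    have h0 : Nat.find hex ≠ 0 := fun h => by
      rw [h, pow_zero, Matrix.vecMul_one] at hs
      exact hw (by rw [hs, Matrix.zero_vecMul])
    have h1 : Nat.find hex ≠ 1 := fun h => by
      rw [h, pow_one] at hs
      exact hw hs
    refine ⟨Nat.find hex - 2, hm _ (by omega), ?_⟩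
    rwa [Nat.sub_add_cancel (by omega)]
  have key : ∀ i : ℕ, Matrix.vecMul (Matrix.vecMul w ((A - 1) ^ t)) (A ^ i)
      = Matrix.vecMul w ((A - 1) ^ t) + (i : ℤ) • Matrix.vecMul w ((A - 1) ^ (t + 1)) := by
    intro i
    induction i with
    | zero => simp
    | succ i ih =>
      have h1 : ∀ u : Fin N → ℤ, Matrix.vecMul u A = u + Matrix.vecMul u (A - 1) := fun u => by
        rw [Matrix.vecMul_sub, Matrix.vecMul_one]; abel
      rw [pow_succ, ← Matrix.vecMul_vecMul, ih, h1, Matrix.add_vecMul, Matrix.smul_vecMul,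
        Matrix.vecMul_vecMul, Matrix.vecMul_vecMul, ← pow_succ, ← pow_succ, ht1]
      push_cast
      rw [smul_zero, add_zero, add_smul, one_smul, add_assoc]
  have hcomm : ∀ i : ℕ, (A - 1) ^ t * A ^ i = A ^ i * (A - 1) ^ t := fun i =>
    (((Commute.refl A).sub_left (Commute.one_left A)).pow_pow t i)
  intro i j hij
  have h1 : Matrix.vecMul (Matrix.vecMul w ((A - 1) ^ t)) (A ^ i)
      = Matrix.vecMul (Matrix.vecMul w ((A - 1) ^ t)) (A ^ j) := by
    have := congrArg (fun u => Matrix.vecMul u ((A - 1) ^ t)) hij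
    simpa only [Matrix.vecMul_vecMul, hcomm] using this
  rw [key, key, add_right_inj] at h1
  exact_mod_cast smul_left_injective ℤ ht h1

end UnipotentOrbit

section SkewErgodic

variable {N M : ℕ} [NeZero M]

lemma setIntegral_mFourier_affine {A : Matrix (Fin N) (Fin N) ℤ} {α : Fin N → Torus}
    (hmp : MeasurePreserving (fun x => α + torusMul A x) volume volume)
    (w : Fin N → ℤ) {E : Set (Fin N → Torus)} (hE : MeasurableSet E) :
    ∫ x in E, UnitAddTorus.mFourier w x = UnitAddTorus.mFourier w α *
      ∫ x in (fun x => α + torusMul A x) ⁻¹' E,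
        UnitAddTorus.mFourier (Matrix.vecMul w A) x := by
  have h := hmp.restrict_preimage hE
  rw [← h.map_eq, integral_map h.measurable.aemeasurable
    (UnitAddTorus.mFourier w).continuous.aestronglyMeasurable, ← integral_const_mul]
  exact integral_congr_ae (ae_of_all _ fun x => by
    simp only [mFourier_apply_add, mFourier_torusMul])

lemma norm_mFourier_apply {ι : Type*} [Fintype ι] (w : ι → ℤ) (x : ι → Torus) :
    ‖UnitAddTorus.mFourier w x‖ = 1 := by
  rw [mFourier_eq_toCircle]; exact Circle.norm_coe _

/-- An affine unipotent map of a torus times a cyclic rotation is ergodic when the translation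
vector has no finite order modulo the characters fixed by the linear part. -/
lemma ergodic_weylT_cyclic [TopologicalSpace (ZMod M)] [MeasurableSpace (ZMod M)]
    [MeasurableSingletonClass (ZMod M)]
    {A : Matrix (Fin N) (Fin N) ℤ} (hA : (A - 1) ^ N = 0) (α : Fin N → Torus)
    (hα : ∀ w : Fin N → ℤ, w ≠ 0 → Matrix.vecMul w (A - 1) = 0 →
      ∀ n : ℕ, 0 < n → (n : ℕ) • torusDot w α ≠ 0)
    (U : ((Fin N → Torus) × ZMod M) ≃+ ((Fin N → Torus) × ZMod M))
    (hU : ∀ x g, U (x, g) = (torusMul A x, g)) :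
    Ergodic (weylT (α, 1) U) (weylMeasure N (ZMod M)) := by
  set τ : (Fin N → Torus) → (Fin N → Torus) := fun x => α + torusMul A x with hτ
  have hsurj : Function.Surjective (torusMul A) := fun y => by
    obtain ⟨⟨x, g⟩, hx⟩ := U.surjective (y, 0)
    rw [hU] at hx
    exact ⟨x, congrArg Prod.fst hx⟩
  have hmp : MeasurePreserving τ volume volume :=
    (measurePreserving_add_left volume α).comp
      (AddMonoidHom.measurePreserving (continuous_torusMul A) hsurj rfl)
  have hT : ⇑(weylT (α, 1) U) = Prod.map τ (fun g : ZMod M => 1 + g) := by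
    funext ⟨x, g⟩
    show (α, 1) + U (x, g) = _
    rw [hU]
    rfl
  have hrot : MeasurePreserving (fun g : ZMod M => 1 + g)
      ((Fintype.card (ZMod M) : ENNReal)⁻¹ • Measure.count)
      ((Fintype.card (ZMod M) : ENNReal)⁻¹ • Measure.count) := by
    have hm : Measurable fun g : ZMod M => 1 + g := measurable_of_finite _
    refine ⟨hm, ?_⟩
    ext s hs
    rw [Measure.map_apply hm hs, Measure.smul_apply, Measure.smul_apply]
    congr 1
    rw [Measure.count_apply (hm hs), Measure.count_apply hs]
    congr 1
    exact Set.encard_preimage_of_bijective (Equiv.addLeft (1 : ZMod M)).bijective s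
  refine ⟨?_, ⟨fun E hE hinv => ?_⟩⟩
  · rw [hT]
    exact hmp.prod hrot
  set fib : ZMod M → Set (Fin N → Torus) := fun g => {x | (x, g) ∈ E} with hfib
  have hEm : ∀ g, MeasurableSet (fib g) := fun g => measurable_prodMk_right hE
  have hstep : ∀ g, τ ⁻¹' fib (1 + g) = fib g := fun g => by
    ext x
    have : (x, g) ∈ weylT (α, 1) U ⁻¹' E ↔ (x, g) ∈ E := by rw [hinv]
    rw [hT] at this
    exact this
  have hF : ∀ (n : ℕ) (w : Fin N → ℤ) (g : ZMod M),
      ‖∫ x in fib (n + g), UnitAddTorus.mFourier w x‖ =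
        ‖∫ x in fib g, UnitAddTorus.mFourier (Matrix.vecMul w (A ^ n)) x‖ := by
    intro n
    induction n with
    | zero => simp
    | succ n ih =>
      intro w g
      rw [show ((n + 1 : ℕ) : ZMod M) + g = 1 + (n + g) by push_cast; ring,
        setIntegral_mFourier_affine hmp w (hEm _), hstep, norm_mul, norm_mFourier_apply, one_mul,
        ih, Matrix.vecMul_vecMul, ← pow_succ']
  have hG : ∀ (n : ℕ) (w : Fin N → ℤ) (g : ZMod M), Matrix.vecMul w (A - 1) = 0 →
      ∫ x in fib (n + g), UnitAddTorus.mFourier w x =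
        UnitAddTorus.mFourier w α ^ n * ∫ x in fib g, UnitAddTorus.mFourier w x := by
    intro n w g hw
    have hw' : Matrix.vecMul w A = w := by
      rwa [Matrix.vecMul_sub, Matrix.vecMul_one, sub_eq_zero] at hw
    induction n with
    | zero => simp
    | succ n ih =>
      rw [show ((n + 1 : ℕ) : ZMod M) + g = 1 + (n + g) by push_cast; ring,
        setIntegral_mFourier_affine hmp w (hEm _), hstep, hw', ih]
      ring
  have hM : 0 < M := NeZero.pos M
  have hzero : ∀ g, ∀ w ≠ 0, ∫ x in fib g, UnitAddTorus.mFourier w x = 0 := by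
    intro g w hw
    by_cases hw0 : Matrix.vecMul w (A - 1) = 0
    · have h1 := hG M w g hw0
      rw [ZMod.natCast_self, zero_add] at h1
      by_contra h0
      have h2 : UnitAddTorus.mFourier w α ^ M = 1 :=
        mul_right_cancel₀ h0 (by rw [one_mul, ← h1])
      refine hα w hw hw0 M hM (AddCircle.injective_toCircle one_ne_zero ?_)
      rw [AddCircle.toCircle_nsmul, AddCircle.toCircle_zero]
      ext
      rw [mFourier_eq_toCircle] at h2
      simpa using h2
    · refine setIntegral_mFourier_eq_zero_of_injective (hEm g)
        (v := fun i => Matrix.vecMul w (A ^ (M * i)))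
        ((injective_vecMul_pow hA hw0).comp (mul_right_injective₀ hM.ne')) fun i => ?_
      rw [← hF]
      simp
  have hdich := fun g => measure_eq_zero_or_compl_of_setIntegral_mFourier (hEm g) (hzero g)
  have hconst : ∀ (n : ℕ), volume (fib n) = volume (fib 0) := by
    intro n
    induction n with
    | zero => simp
    | succ n ih =>
      rw [← ih, ← hstep n, add_comm (1 : ZMod M), ← Nat.cast_succ,
        hmp.measure_preimage (hEm _).nullMeasurableSet]
  have hconst' : ∀ g, volume (fib g) = volume (fib 0) := fun g => by
    rw [← ZMod.natCast_zmod_val g, hconst]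
  have hnull : ∀ {S : Set ((Fin N → Torus) × ZMod M)},
      (∀ g, volume {x | (x, g) ∈ S} = 0) → weylMeasure N (ZMod M) S = 0 := fun {S} h => by
    by_contra h0
    obtain ⟨g, hg⟩ := weylMeasure_pos_iff.1 (pos_iff_ne_zero.2 h0)
    exact hg.ne' (h g)
  rw [eventuallyConst_set]
  by_cases h0 : volume (fib 0) = 0
  · right
    rw [ae_iff]
    simp only [not_not, Set.ofPred_mem_eq]
    exact hnull fun g => (hconst' g).trans h0
  · left
    rw [ae_iff]
    refine hnull fun g => ?_
    exact (hdich g).resolve_left fun h => h0 ((hconst' g).symm.trans h)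

end SkewErgodic

section ShiftSystem

variable {N : ℕ}

/-- The matrix of the map sending the `j`-th coordinate to the `(j - a)`-th one. -/
def shiftMatrix (a N : ℕ) : Matrix (Fin N) (Fin N) ℤ :=
  fun j i => if (i : ℕ) + a = j then 1 else 0

lemma shiftMatrix_pow_eq_zero {a : ℕ} (ha : 0 < N → 0 < a) : shiftMatrix a N ^ N = 0 := by
  have key : ∀ (n : ℕ) (j i : Fin N), (shiftMatrix a N ^ n) j i ≠ 0 → (i : ℕ) + n ≤ j := by
    intro n
    induction n with
    | zero =>
      intro j i h
      rw [pow_zero, Matrix.one_apply] at h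
      have : j = i := by by_contra h'; exact h (if_neg h')
      simp [this]
    | succ n ih =>
      intro j i h
      rw [pow_succ, Matrix.mul_apply] at h
      obtain ⟨m, -, hm⟩ := Finset.exists_ne_zero_of_sum_ne_zero h
      have h1 := ih j m (left_ne_zero_of_mul hm)
      have h2 : (i : ℕ) + a = m := by
        by_contra h'
        exact right_ne_zero_of_mul hm (if_neg h')
      have := ha (by have := j.isLt; omega)
      omega
  ext j i
  by_contra h
  have := key N j i h
  omega

/-- The automorphism of `𝕋^N × F` acting by a unipotent matrix on the torus and trivially on the
finite group. -/
def unipotentEquiv (F : Type) [AddCommGroup F] {B : Matrix (Fin N) (Fin N) ℤ}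
    (u : (Matrix (Fin N) (Fin N) ℤ)ˣ) (hu : (u : Matrix (Fin N) (Fin N) ℤ) = B) :
    ((Fin N → Torus) × F) ≃+ ((Fin N → Torus) × F) where
  toFun x := (torusMul B x.1, x.2)
  invFun x := (torusMul (↑u⁻¹ : Matrix (Fin N) (Fin N) ℤ) x.1, x.2)
  left_inv x := by
    subst hu
    simp [← torusMul_mul, torusMul_one]
  right_inv x := by
    subst hu
    simp [← torusMul_mul, torusMul_one]
  map_add' x y := by simp

/-- A vector `α` of length `a` followed by the coordinates of `x`, as a sequence. -/
def extCoord {a : ℕ} (α : Fin a → Torus) (x : Fin N → Torus) (n : ℕ) : Torus :=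
  if h : n < a then α ⟨n, h⟩ else if h' : n - a < N then x ⟨n - a, h'⟩ else 0

/-- The vector `α`, truncated or continued by zero to length `N`. -/
def padVector {a : ℕ} (N : ℕ) (α : Fin a → Torus) (j : Fin N) : Torus :=
  if h : (j : ℕ) < a then α ⟨j, h⟩ else 0

lemma extCoord_of_lt {a : ℕ} (α : Fin a → Torus) (x : Fin N → Torus) {n : ℕ} (h : n < a) :
    extCoord α x n = α ⟨n, h⟩ := dif_pos h

lemma extCoord_add {a : ℕ} (α : Fin a → Torus) (x : Fin N → Torus) {n : ℕ} (h : n < N) :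
    extCoord α x (n + a) = x ⟨n, h⟩ := by
  simp [extCoord, h]

lemma extCoord_affine {a : ℕ} (α : Fin a → Torus) (x : Fin N → Torus) {n : ℕ} (h : n < N) :
    extCoord α (padVector N α + torusMul (1 + shiftMatrix a N) x) (n + a)
      = extCoord α x (n + a) + extCoord α x n := by
  rw [extCoord_add _ _ h, extCoord_add _ _ h, Pi.add_apply, torusMul_apply]
  simp only [Matrix.add_apply, add_smul, Finset.sum_add_distrib]
  rw [← torusMul_apply, torusMul_one, add_left_comm]
  congr 1
  by_cases hn : n < a
  · rw [extCoord_of_lt _ _ hn, Finset.sum_eq_zero, add_zero, padVector, dif_pos hn]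
    intro i _
    rw [shiftMatrix, if_neg, zero_smul]
    simp only
    omega
  · rw [padVector, dif_neg hn, zero_add, extCoord, dif_neg hn, dif_pos (by omega),
      Finset.sum_eq_single ⟨n - a, by omega⟩]
    · rw [shiftMatrix, if_pos, one_smul]
      simp only
      omega
    · intro i _ hi
      rw [shiftMatrix, if_neg, zero_smul]
      intro h'
      apply hi
      ext
      simp only at h' ⊢
      omega
    · simp

lemma extCoord_zpow {a : ℕ} (α : Fin a → Torus) {F : Type} (T : Equiv.Perm ((Fin N → Torus) × F))
    (hT : ∀ x, (T x).1 = padVector N α + torusMul (1 + shiftMatrix a N) x.1)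
    (x : (Fin N → Torus) × F) (K : ℤ) (i l : ℕ) (hl : l < a) (hi : i * a + l < N + a) :
    extCoord α ((T ^ K) x).1 (i * a + l) =
      ∑ c ∈ Finset.range (i + 1), Ring.choose K (i - c) • extCoord α x.1 (c * a + l) := by
  have hstep : ∀ (K : ℤ) (i : ℕ), (i + 1) * a + l < N + a →
      extCoord α ((T ^ (K + 1)) x).1 ((i + 1) * a + l) =
        extCoord α ((T ^ K) x).1 ((i + 1) * a + l) + extCoord α ((T ^ K) x).1 (i * a + l) := by
    intro K i hi
    rw [add_comm K 1, zpow_add, zpow_one, Equiv.Perm.mul_apply, hT,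
      show (i + 1) * a + l = i * a + l + a by ring]
    exact extCoord_affine _ _ (by linarith)
  have hsum : ∀ (K : ℤ) (i : ℕ), ∑ c ∈ Finset.range (i + 1 + 1),
      Ring.choose (K + 1) (i + 1 - c) • extCoord α x.1 (c * a + l) =
      ∑ c ∈ Finset.range (i + 1 + 1), Ring.choose K (i + 1 - c) • extCoord α x.1 (c * a + l) +
      ∑ c ∈ Finset.range (i + 1), Ring.choose K (i - c) • extCoord α x.1 (c * a + l) := by
    intro K i
    rw [Finset.sum_range_succ, Finset.sum_range_succ _ (i + 1), add_right_comm,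
      ← Finset.sum_add_distrib]
    congr 1
    · refine Finset.sum_congr rfl fun c hc => ?_
      have : i + 1 - c = i - c + 1 := by have := Finset.mem_range.1 hc; omega
      rw [this, Ring.choose_succ_succ, add_smul, add_comm]
    · simp
  have hlow : ∀ K : ℤ, extCoord α ((T ^ K) x).1 (0 * a + l) = extCoord α x.1 (0 * a + l) := by
    intro K
    rw [extCoord_of_lt _ _ (by simpa), extCoord_of_lt _ _ (by simpa)]
  induction K using Int.induction_on generalizing i with
  | zero =>
    rw [Finset.sum_range_succ, Finset.sum_eq_zero]
    · simp
    · intro c hc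
      have : 0 < i - c := by have := Finset.mem_range.1 hc; omega
      rw [Ring.choose_zero_pos ℤ this, zero_smul]
  | succ K ih =>
    cases i with
    | zero => rw [hlow]; simp
    | succ i =>
      rw [hstep _ _ hi, ih _ hi, ih _ (by linarith), hsum]
  | pred K ih =>
    induction i with
    | zero => rw [hlow]; simp
    | succ i ih' =>
      have h1 := hstep (-(K : ℤ) - 1) i hi
      have h2 := hsum (-(K : ℤ) - 1) i
      rw [sub_add_cancel] at h1 h2
      rw [ih _ hi, h2, ih' (by linarith)] at h1
      exact (add_right_cancel h1).symm

end ShiftSystem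

section ShiftRecurrence

lemma dvd_choose_of_mul_factorial_dvd {M d : ℕ} {K : ℤ} (h : ((M * d.factorial : ℕ) : ℤ) ∣ K)
    {j : ℕ} (hj : 0 < j) (hjd : j ≤ d) : (M : ℤ) ∣ Ring.choose K j := by
  have h1 : K ∣ (j.factorial : ℤ) * Ring.choose K j := by
    rw [← prod_range_sub_eq_factorial_mul_choose]
    have := Finset.dvd_prod_of_mem (fun i : ℕ => K - (i : ℤ)) (Finset.mem_range.2 hj)
    simpa using this
  have h2 : ((j.factorial * M : ℕ) : ℤ) ∣ (j.factorial : ℤ) * Ring.choose K j := by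
    refine dvd_trans (Int.natCast_dvd_natCast.2 ?_) (h.trans h1)
    rw [mul_comm]
    exact mul_dvd_mul_left _ (Nat.factorial_dvd_factorial hjd)
  rw [Nat.cast_mul] at h2
  exact Int.dvd_of_mul_dvd_mul_left (by exact_mod_cast j.factorial_ne_zero) h2

variable {r : ℕ} {P : Fin r → ℝ[X]}

lemma norm_zsmul_le_of_return {d a : ℕ} {F : Type} (hP : ∀ k, IsIntegralPoly (P k))
    (α : Fin a → Torus) (T : Equiv.Perm ((Fin (d * a) → Torus) × F))
    (hT : ∀ x, (T x).1 = padVector (d * a) α + torusMul (1 + shiftMatrix a (d * a)) x.1)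
    {u : ℕ → Fin r → ℤ} (hu : IsWeylVector P d fun i m => (u i m : ℝ)) {n Z : ℤ}
    (hZ : (weylPoly P (fun i m => (u i m : ℝ)) d 0).eval (n : ℝ) = Z) {δ : ℝ}
    {x : (Fin (d * a) → Torus) × F} (hx : ∀ j, ‖x.1 j‖ < δ)
    (hxT : ∀ m j, ‖((T ^ ieval (P m) n) x).1 j‖ < δ) (l : Fin a) :
    ‖Z • α l‖ ≤ ∑ i ∈ Finset.range d, ∑ m, |(u i m : ℝ)| * (2 * δ) := by
  set W : ℕ → ℤ := fun c => ∑ i ∈ Finset.range d,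
    if c ≤ i then ∑ m, u i m * Ring.choose (ieval (P m) n) (i - c + 1) else 0 with hW
  have hWe : ∀ c, (weylPoly P (fun i m => (u i m : ℝ)) d c).eval (n : ℝ) = W c := fun c => by
    rw [eval_weylPoly hP, hW]
    push_cast
    rfl
  have hW0 : W 0 = Z := by
    have := (hWe 0).symm.trans hZ
    exact_mod_cast this
  have hWs : ∀ c, c + 1 < d → W (c + 1) = 0 := fun c hc => by
    have := hWe (c + 1)
    rw [hu c hc, eval_zero] at this
    exact_mod_cast this.symm
  set X : ℕ → Torus := fun c => extCoord α x.1 (c * a + l) with hX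
  have hlt : ∀ i < d, i * a + (l : ℕ) < d * a := fun i hi => by
    have h1 : (i + 1) * a ≤ d * a := Nat.mul_le_mul_right a hi
    have h2 := l.isLt
    rw [add_mul, one_mul] at h1
    omega
  have hdisp : ∀ i < d, ∀ m,
      extCoord α ((T ^ ieval (P m) n) x).1 ((i + 1) * a + l) - X (i + 1) =
        ∑ c ∈ Finset.range (i + 1), Ring.choose (ieval (P m) n) (i - c + 1) • X c := by
    intro i hi m
    rw [extCoord_zpow α T hT x _ (i + 1) l l.isLt (by have := hlt i hi; linarith),
      Finset.sum_range_succ, Nat.sub_self, Ring.choose_zero_right, one_smul, add_sub_cancel_right]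
    refine Finset.sum_congr rfl fun c hc => ?_
    rw [show i + 1 - c = i - c + 1 by have := Finset.mem_range.1 hc; omega]
  have hsmall : ∀ i < d, ∀ m,
      ‖extCoord α ((T ^ ieval (P m) n) x).1 ((i + 1) * a + l) - X (i + 1)‖ ≤ 2 * δ := by
    intro i hi m
    have e : (i + 1) * a + (l : ℕ) = i * a + l + a := by ring
    rw [hX]
    simp only [e]
    rw [extCoord_add _ _ (hlt i hi), extCoord_add _ _ (hlt i hi)]
    refine (norm_sub_le _ _).trans ?_
    linarith [hx ⟨_, hlt i hi⟩, hxT m ⟨_, hlt i hi⟩]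
  have hmain : Z • α l = ∑ i ∈ Finset.range d, ∑ m, u i m •
      (extCoord α ((T ^ ieval (P m) n) x).1 ((i + 1) * a + l) - X (i + 1)) := by
    have h1 : ∑ c ∈ Finset.range d, W c • X c = Z • α l := by
      cases d with
      | zero => simp [← hW0, hW]
      | succ d =>
        rw [Finset.sum_range_succ', Finset.sum_eq_zero, zero_add, hW0, hX]
        · simp only [zero_mul, zero_add]
          rw [extCoord_of_lt _ _ l.isLt]
        · intro c hc
          rw [hWs c (by have := Finset.mem_range.1 hc; omega), zero_smul]
    rw [← h1]
    simp only [hW, Finset.sum_smul]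
    rw [Finset.sum_comm]
    refine Finset.sum_congr rfl fun i hi => ?_
    have hi' := Finset.mem_range.1 hi
    have h2 := hdisp i hi'
    simp only [h2, Finset.smul_sum]
    rw [Finset.sum_comm, ← Finset.sum_subset (Finset.range_mono hi' : Finset.range (i + 1) ⊆ Finset.range d)]
    · refine Finset.sum_congr rfl fun c hc => ?_
      rw [if_pos (by have := Finset.mem_range.1 hc; omega), Finset.sum_smul]
      exact Finset.sum_congr rfl fun m _ => mul_smul _ _ _
    · intro c _ hc
      rw [if_neg (by simpa using hc), zero_smul]
  rw [hmain]
  refine (norm_sum_le _ _).trans (Finset.sum_le_sum fun i hi => ?_)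
  refine (norm_sum_le _ _).trans (Finset.sum_le_sum fun m _ => ?_)
  refine (norm_zsmul_le _ _).trans ?_
  rw [Int.norm_eq_abs]
  exact mul_le_mul_of_nonneg_left (hsmall i (Finset.mem_range.1 hi) m) (abs_nonneg _)

lemma nsmul_torusDot_padVector_ne_zero {N a M : ℕ} (haN : a ≤ N) (hM : 0 < M) {α : Fin a → ℝ}
    (hind : ∀ (k : Fin a → ℤ) (k₀ : ℤ), ∑ l, k l * α l + k₀ / M = 0 → k = 0 ∧ k₀ = 0)
    {w : Fin N → ℤ} (hw : w ≠ 0) (hws : Matrix.vecMul w (shiftMatrix a N) = 0)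
    {n : ℕ} (hn : 0 < n) :
    n • torusDot w (padVector N fun l => (α l : Torus)) ≠ 0 := by
  have hM0 : (M : ℝ) ≠ 0 := by positivity
  intro h0
  apply hw
  have hlarge : ∀ j : Fin N, a ≤ j → w j = 0 := by
    intro j hj
    have h1 := congrFun hws ⟨j - a, by omega⟩
    rw [Matrix.vecMul, dotProduct, Finset.sum_eq_single j] at h1
    · rw [shiftMatrix, if_pos (by simp only; omega)] at h1
      simpa using h1
    · intro i _ hi
      rw [shiftMatrix, if_neg, mul_zero]
      intro h'
      apply hi
      ext
      simp only at h'
      omega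
    · simp
  have hdot : torusDot w (padVector N fun l => (α l : Torus)) =
      torusDot (fun l : Fin a => w (Fin.castLE haN l)) (fun l => (α l : Torus)) := by
    symm
    refine Fintype.sum_of_injective (Fin.castLE haN) (Fin.castLE_injective haN) _ _ ?_ ?_
    · intro j hj
      rw [padVector, dif_neg, smul_zero]
      exact fun h => hj ⟨⟨j, h⟩, rfl⟩
    · intro l
      rw [padVector, dif_pos (by simp)]
      rfl
  rw [hdot, torusDot_coe, ← AddCircle.coe_nsmul, AddCircle.coe_eq_zero_iff] at h0
  obtain ⟨p, hp⟩ := h0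
  have h1 := (hind (fun l => n * w (Fin.castLE haN l)) (-(p * M)) (by
    push_cast
    rw [neg_div, mul_div_cancel_right₀ _ hM0]
    rw [zsmul_eq_mul, mul_one, nsmul_eq_mul, Finset.mul_sum] at hp
    rw [hp, ← sub_eq_add_neg, sub_eq_zero]
    exact Finset.sum_congr rfl fun l _ => by ring)).1
  ext j
  by_cases hj : (j : ℕ) < a
  · have := congrFun h1 ⟨j, hj⟩
    simp only [Pi.zero_apply, mul_eq_zero] at this
    exact this.resolve_left (by exact_mod_cast hn.ne')
  · exact hlarge j (by omega)

end ShiftRecurrence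

section KroneckerRecurrence

variable {r : ℕ} {P : Fin r → ℝ[X]}

/-- Topological multiple recurrence of Weyl systems along the values of the family `P` on `R`. -/
def TopologicalWeylRecurrence (P : Fin r → ℝ[X]) (R : Set ℕ) : Prop :=
  ∀ (N : ℕ) (F : Type) [AddCommGroup F] [Fintype F]
    [TopologicalSpace F] [DiscreteTopology F]
    [MeasurableSpace F] [MeasurableSingletonClass F]
    (a : (Fin N → Torus) × F)
    (U : ((Fin N → Torus) × F) ≃+ ((Fin N → Torus) × F))
    (A : Matrix (Fin N) (Fin N) ℤ), IsWeylSystemWith a U A →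
    ∀ V : Set ((Fin N → Torus) × F), IsOpen V → V.Nonempty →
      ∃ n ∈ R, (V ∩ ⋂ k : Fin r, (weylT a U ^ (ieval (P k) (n : ℤ))) ⁻¹' V).Nonempty

lemma snd_zpow_of_snd_eq {X F : Type*} [AddCommGroup F] {T : Equiv.Perm (X × F)} {f : F}
    (hT : ∀ x, (T x).2 = f + x.2) (x : X × F) (K : ℤ) : ((T ^ K) x).2 = K • f + x.2 := by
  have hs : ∀ K : ℤ, ((T ^ (K + 1)) x).2 = f + ((T ^ K) x).2 := fun K => by
    rw [add_comm K 1, zpow_add, zpow_one, Equiv.Perm.mul_apply, hT]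
  induction K using Int.induction_on with
  | zero => simp
  | succ K ih => rw [hs, ih, add_smul, one_smul]; abel
  | pred K ih =>
    have h := hs (-(K : ℤ) - 1)
    rw [sub_add_cancel, ih] at h
    rw [sub_smul, one_smul, ← add_right_inj f, ← h]
    abel

lemma TopologicalWeylRecurrence.exists_norm_zsmul_le (hP : ∀ k, IsIntegralPoly (P k)) {R : Set ℕ}
    (H : TopologicalWeylRecurrence P R) {d a M M' : ℕ} (hd : 0 < d) (hM : 0 < M) (hM' : 0 < M')
    {α : Fin a → ℝ}
    (hind : ∀ (k : Fin a → ℤ) (k₀ : ℤ), ∑ l, k l * α l + k₀ / M = 0 → k = 0 ∧ k₀ = 0)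
    {δ : ℝ} (hδ : 0 < δ) :
    ∃ n ∈ R, (∀ m, (M' : ℤ) ∣ ieval (P m) (n : ℤ)) ∧
      ∀ (u : ℕ → Fin r → ℤ) (Z : ℤ), IsWeylVector P d (fun i m => (u i m : ℝ)) →
        (weylPoly P (fun i m => (u i m : ℝ)) d 0).eval (n : ℝ) = Z → ∀ l,
        ‖Z • (α l : Torus)‖ ≤ ∑ i ∈ Finset.range d, ∑ m, |(u i m : ℝ)| * (2 * δ) := by
  have : NeZero M' := ⟨hM'.ne'⟩
  let : TopologicalSpace (ZMod M') := ⊥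
  have : DiscreteTopology (ZMod M') := ⟨rfl⟩
  let : MeasurableSpace (ZMod M') := ⊤
  set S := shiftMatrix a (d * a) with hS
  have hSN : S ^ (d * a) = 0 := shiftMatrix_pow_eq_zero fun h => Nat.pos_of_mul_pos_left h
  obtain ⟨u₀, hu₀⟩ := (show IsNilpotent S from ⟨_, hSN⟩).isUnit_one_add
  set U := unipotentEquiv (ZMod M') u₀ hu₀ with hU
  set α' : Fin (d * a) → Torus := padVector (d * a) fun l => (α l : Torus) with hα'
  have hA : (1 + S - 1) ^ (d * a) = 0 := by rwa [add_sub_cancel_left]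
  have hW : IsWeylSystemWith (α', (1 : ZMod M')) U (1 + S) := by
    refine ⟨hA, ?_, fun x => rfl, ?_⟩
    · exact ((continuous_torusMul (1 + S)).comp continuous_fst).prodMk continuous_snd
    · refine ergodic_weylT_cyclic hA α' (fun w hw hws n hn => ?_) U fun x g => rfl
      rw [add_sub_cancel_left] at hws
      exact nsmul_torusDot_padVector_ne_zero (Nat.le_mul_of_pos_left a hd) hM hind hw hws hn
  obtain ⟨n, hn, x, hx, hxT⟩ := H (d * a) (ZMod M') (α', 1) U (1 + S) hW
    {p | (∀ j, ‖p.1 j‖ < δ) ∧ p.2 = 0} (by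
      rw [Set.ofPred_and, Set.ofPred_forall]
      refine (isOpen_iInter_of_finite fun j => isOpen_lt (by fun_prop) (by fun_prop)).inter ?_
      exact (isOpen_discrete {(0 : ZMod M')}).preimage continuous_snd)
    ⟨0, fun j => by simpa using hδ, rfl⟩
  rw [Set.mem_iInter] at hxT
  refine ⟨n, hn, fun m => ?_, fun u Z hu hZ l => ?_⟩
  · have h1 := snd_zpow_of_snd_eq (T := weylT (α', (1 : ZMod M')) U) (f := 1)
      (fun _ => rfl) x (ieval (P m) n)
    rw [(hxT m).2, hx.2, add_zero, zsmul_eq_mul, mul_one] at h1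
    exact (ZMod.intCast_zmod_eq_zero_iff_dvd _ _).1 h1.symm
  · exact norm_zsmul_le_of_return hP (fun l => (α l : Torus)) (weylT (α', (1 : ZMod M')) U)
      (fun _ => rfl) hu (n := n) (by simpa using hZ) hx.1 (fun m => (hxT m).1) l

lemma TopologicalWeylRecurrence.exists_norm_ieval_smul_lt (hP : ∀ k, IsIntegralPoly (P k))
    {R : Set ℕ} (H : TopologicalWeylRecurrence P R) {d s : ℕ} (hd : 0 < d) (β : Fin s → Torus)
    {m : ℕ} (q : Fin m → ℝ[X]) (hq : ∀ i, q i ∈ WP P d ∧ IsIntegralPoly (q i))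
    {ε : ℝ} (hε : 0 < ε) :
    ∃ n ∈ R, ∀ i j, ‖(ieval (q i) (n : ℤ)) • β j‖ < ε := by
  obtain ⟨k, rfl⟩ : ∃ k, d = k + 1 := ⟨d - 1, by omega⟩
  choose v hv hqv using fun i => exists_weylVector_of_mem_WP (hq i).1
  obtain ⟨a₀, α₀, D, z, u, hD, hexp, hind₀⟩ :=
    exists_integer_weylPoly_expansion (P := P) v (k + 1)
  have hu : ∀ i, IsWeylVector P (k + 1) fun i' m => (u i i' m : ℝ) := fun i =>
    ((hv i).of_expansion hP hD hind₀ (hexp i)).2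
  have huq : ∀ i, weylPoly P (fun i' m => (u i i' m : ℝ)) (k + 1) 0 = C (D : ℝ) * q i := fun i =>
    (eq_of_integer_weylPoly_expansion hD hind₀ (hq i).2
      (fun l => isIntegralPoly_weylPoly_intCast hP _ _ _)
      (isIntegralPoly_weylPoly_intCast hP _ _ _) ((hqv i).trans (hexp i 0))).2
  have hD0 : (D : ℝ) ≠ 0 := by positivity
  choose B hB using fun j => QuotientAddGroup.mk_surjective (β j)
  obtain ⟨a, α, M, y, y₀, hM, hb, hind⟩ := exists_independent_expansion fun j => B j / D
  have hM0 : (M : ℝ) ≠ 0 := by positivity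
  set Cu : Fin m → ℝ := fun i => ∑ i' ∈ Finset.range (k + 1), ∑ m, |(u i i' m : ℝ)| with hCu
  set Cy : Fin s → ℝ := fun j => ∑ l, |(y j l : ℝ)| with hCy
  have hCu0 : ∀ i, 0 ≤ Cu i := fun i => by positivity
  have hCy0 : ∀ j, 0 ≤ Cy j := fun j => by positivity
  set K : ℝ := (∑ i, Cu i) * (∑ j, Cy j) + 1 with hK
  have hKpos : 0 < K := by positivity
  have hKle : ∀ i j, Cu i * Cy j < K := fun i j => by
    have h1 := Finset.single_le_sum (fun i _ => hCu0 i) (Finset.mem_univ i)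
    have h2 := Finset.single_le_sum (fun j _ => hCy0 j) (Finset.mem_univ j)
    have := mul_le_mul h1 h2 (hCy0 j) (by positivity)
    linarith
  obtain ⟨n, hn, hdvd, hnorm⟩ := H.exists_norm_zsmul_le hP (d := k + 1)
    (M' := M * (k + 1).factorial) (by omega) hM (by positivity) hind
    (show 0 < ε / (2 * K) by positivity)
  refine ⟨n, hn, fun i j => ?_⟩
  set Z : ℤ := D * ieval (q i) n with hZ
  have hZe : (weylPoly P (fun i' m => (u i i' m : ℝ)) (k + 1) 0).eval (n : ℝ) = Z := by
    have := (hq i).2.cast_ieval n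
    rw [Int.cast_natCast] at this
    rw [huq, eval_mul, eval_C, hZ, ← this]
    push_cast
    rfl
  have hMZ : (M : ℤ) ∣ Z := by
    have h1 := eval_weylPoly hP (fun i' m => (u i i' m : ℝ)) (k + 1) 0 n
    rw [Int.cast_natCast, hZe] at h1
    have h2 : Z = ∑ i' ∈ Finset.range (k + 1), if 0 ≤ i' then
        ∑ m, u i i' m * Ring.choose (ieval (P m) n) (i' - 0 + 1) else 0 := by
      exact_mod_cast h1
    rw [h2]
    refine Finset.dvd_sum fun i' hi' => ?_
    rw [if_pos (Nat.zero_le _)]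
    refine Finset.dvd_sum fun m' _ => Dvd.dvd.mul_left ?_ _
    exact dvd_choose_of_mul_factorial_dvd (hdvd m') (by omega)
      (by have := Finset.mem_range.1 hi'; omega)
  obtain ⟨t, ht⟩ := hMZ
  have hβ : ieval (q i) n • β j = ∑ l, y j l • Z • (α l : Torus) := by
    have h1 : ((ieval (q i) n : ℤ) : ℝ) * B j =
        ∑ l, (y j l : ℝ) * (Z * α l) + ((t * y₀ j : ℤ) : ℝ) := by
      have h2 : B j = D * (∑ l, y j l * α l + y₀ j / M) := by
        rw [← hb j]; field_simp
      have h3 : (Z : ℝ) = D * ieval (q i) n := by rw [hZ]; push_cast; rfl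
      have h4 : (Z : ℝ) = M * t := by rw [ht]; push_cast; rfl
      have h5 : ∑ l, (y j l : ℝ) * (Z * α l) = Z * ∑ l, y j l * α l := by
        rw [Finset.mul_sum]
        exact Finset.sum_congr rfl fun l _ => by ring
      have h6 : ((t * y₀ j : ℤ) : ℝ) = Z * (y₀ j / M) := by
        rw [h4]; push_cast; field_simp
      rw [h5, h6, h2, ← mul_add, h3]
      ring
    have h7 : ieval (q i) n • β j = ((((ieval (q i) n : ℤ) : ℝ) * B j : ℝ) : Torus) := by
      rw [← hB j, ← zsmul_eq_mul]
      rfl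
    have h8 : ((((t * y₀ j : ℤ) : ℝ)) : Torus) = 0 :=
      (AddCircle.coe_eq_zero_iff 1).2 ⟨t * y₀ j, by simp⟩
    have h9 : ((∑ l, (y j l : ℝ) * (Z * α l) : ℝ) : Torus) =
        ∑ l, (((y j l : ℝ) * (Z * α l) : ℝ) : Torus) := map_sum (QuotientAddGroup.mk' _) _ _
    rw [h7, h1, AddCircle.coe_add, h8, add_zero, h9]
    refine Finset.sum_congr rfl fun l _ => ?_
    rw [← AddCircle.coe_zsmul, ← AddCircle.coe_zsmul, zsmul_eq_mul, zsmul_eq_mul]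
  rw [hβ]
  have hl : ∀ l, ‖Z • (α l : Torus)‖ ≤ Cu i * (ε / K) := fun l => by
    refine (hnorm (u i) Z (hu i) hZe l).trans_eq ?_
    simp only [hCu, Finset.sum_mul]
    refine Finset.sum_congr rfl fun i' _ => Finset.sum_congr rfl fun m' _ => ?_
    field_simp
  calc ‖∑ l, y j l • Z • (α l : Torus)‖ ≤ ∑ l, |(y j l : ℝ)| * (Cu i * (ε / K)) := by
        refine (norm_sum_le _ _).trans (Finset.sum_le_sum fun l _ => ?_)
        refine (norm_zsmul_le _ _).trans ?_
        rw [Int.norm_eq_abs]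
        exact mul_le_mul_of_nonneg_left (hl l) (abs_nonneg _)
    _ = Cu i * Cy j * (ε / K) := by rw [← Finset.sum_mul]; ring
    _ < K * (ε / K) := mul_lt_mul_of_pos_right (hKle i j) (by positivity)
    _ = ε := by field_simp

end KroneckerRecurrence

lemma MeasurableSet.of_isOpen_torus_prod {N : ℕ} {F : Type} [Finite F] [TopologicalSpace F]
    [MeasurableSpace F] [MeasurableSingletonClass F] {V : Set ((Fin N → Torus) × F)}
    (hV : IsOpen V) : MeasurableSet V := by
  have h : V = ⋃ g, {x | (x, g) ∈ V} ×ˢ {g} := by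
    ext ⟨x, g⟩
    simp
  rw [h]
  refine MeasurableSet.iUnion fun g => MeasurableSet.prod ?_ (measurableSet_singleton g)
  exact (hV.preimage (by fun_prop : Continuous fun x => (x, g))).measurableSet

/-- Measurable multiple recurrence of Weyl systems along the values of the family `P` on `R`. -/
def MeasurableWeylRecurrence {r : ℕ} (P : Fin r → ℝ[X]) (R : Set ℕ) : Prop :=
  ∀ (N : ℕ) (F : Type) [AddCommGroup F] [Fintype F]
    [TopologicalSpace F] [DiscreteTopology F]
    [MeasurableSpace F] [MeasurableSingletonClass F]
    (a : (Fin N → Torus) × F)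
    (U : ((Fin N → Torus) × F) ≃+ ((Fin N → Torus) × F))
    (A : Matrix (Fin N) (Fin N) ℤ), IsWeylSystemWith a U A →
    ∀ S : Set ((Fin N → Torus) × F), MeasurableSet S → 0 < weylMeasure N F S →
      ∃ n ∈ R, 0 < weylMeasure N F
        (S ∩ ⋂ k : Fin r, (weylT a U ^ (ieval (P k) (n : ℤ))) ⁻¹' S)

lemma MeasurableWeylRecurrence.topological {r : ℕ} {P : Fin r → ℝ[X]} {R : Set ℕ}
    (H : MeasurableWeylRecurrence P R) : TopologicalWeylRecurrence P R :=
  fun N F _ _ _ _ _ _ a U A hW V hV hne => by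
    obtain ⟨n, hn, hpos⟩ := H N F a U A hW V (MeasurableSet.of_isOpen_torus_prod hV)
      (weylMeasure_pos_of_isOpen hV hne)
    exact ⟨n, hn, nonempty_of_measure_ne_zero hpos.ne'⟩

lemma WeylRecurrent.measurableWeylRecurrence {r : ℕ} {P : Fin r → ℝ[X]} {R : Set ℕ}
    (hP : ∀ k, IsIntegralPoly (P k)) (hz : ∀ k, (P k).eval 0 = 0) (hR : WeylRecurrent P R) :
    MeasurableWeylRecurrence P R :=
  fun _ _ _ _ _ _ _ _ _ _ _ hW _ hS hpos => hR.measurable_recurrence hP hz hW hS hpos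

end

noncomputable section

/-- Characterization of measurable and topological polynomial recurrence in Weyl
systems via recurrence for Weyl polynomials in Kronecker systems. -/
theorem stmt15 (r : ℕ) (hr : 1 ≤ r)
    (P : Fin r → Polynomial ℝ)
    (hint : ∀ k, IsIntegralPoly (P k)) (hz : ∀ k, (P k).eval 0 = 0)
    (R : Set ℕ) :
    ((∀ (N : ℕ) (F : Type) [AddCommGroup F] [Fintype F]
        [TopologicalSpace F] [DiscreteTopology F]
        [MeasurableSpace F] [MeasurableSingletonClass F]
        (a : (Fin N → Torus) × F)
        (U : ((Fin N → Torus) × F) ≃+ ((Fin N → Torus) × F))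
        (A : Matrix (Fin N) (Fin N) ℤ), IsWeylSystemWith a U A →
        ∀ S : Set ((Fin N → Torus) × F), MeasurableSet S → 0 < weylMeasure N F S →
          ∃ n ∈ R, 0 < weylMeasure N F
            (S ∩ ⋂ k : Fin r, (weylT a U ^ (ieval (P k) (n : ℤ))) ⁻¹' S)) ↔
      (∀ (N : ℕ) (F : Type) [AddCommGroup F] [Fintype F]
        [TopologicalSpace F] [DiscreteTopology F]
        [MeasurableSpace F] [MeasurableSingletonClass F]
        (a : (Fin N → Torus) × F)
        (U : ((Fin N → Torus) × F) ≃+ ((Fin N → Torus) × F))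
        (A : Matrix (Fin N) (Fin N) ℤ), IsWeylSystemWith a U A →
        ∀ V : Set ((Fin N → Torus) × F), IsOpen V → V.Nonempty →
          ∃ n ∈ R,
            (V ∩ ⋂ k : Fin r, (weylT a U ^ (ieval (P k) (n : ℤ))) ⁻¹' V).Nonempty)) ∧
    ((∀ (N : ℕ) (F : Type) [AddCommGroup F] [Fintype F]
        [TopologicalSpace F] [DiscreteTopology F]
        [MeasurableSpace F] [MeasurableSingletonClass F]
        (a : (Fin N → Torus) × F)
        (U : ((Fin N → Torus) × F) ≃+ ((Fin N → Torus) × F))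
        (A : Matrix (Fin N) (Fin N) ℤ), IsWeylSystemWith a U A →
        ∀ V : Set ((Fin N → Torus) × F), IsOpen V → V.Nonempty →
          ∃ n ∈ R,
            (V ∩ ⋂ k : Fin r, (weylT a U ^ (ieval (P k) (n : ℤ))) ⁻¹' V).Nonempty) ↔
      (∀ (d s : ℕ), 1 ≤ d → 1 ≤ s → ∀ β : Fin s → Torus,
        ∀ (m : ℕ) (q : Fin m → Polynomial ℝ),
          (∀ i, q i ∈ WP P d ∧ IsIntegralPoly (q i)) →
          ∀ ε : ℝ, 0 < ε → ∃ n ∈ R, ∀ (i : Fin m) (j : Fin s),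
            ‖(ieval (q i) (n : ℤ)) • β j‖ < ε)) := by
  have h23 := fun (H2 : TopologicalWeylRecurrence P R) (d s : ℕ) (hd : 1 ≤ d) (_ : 1 ≤ s)
    (β : Fin s → Torus) (m : ℕ) (q : Fin m → Polynomial ℝ)
    (hq : ∀ i, q i ∈ WP P d ∧ IsIntegralPoly (q i)) (ε : ℝ) (hε : 0 < ε) =>
      H2.exists_norm_ieval_smul_lt hint hd β q hq hε
  exact ⟨⟨MeasurableWeylRecurrence.topological, fun H2 =>
      (weylRecurrent_of_integral hint (h23 H2)).measurableWeylRecurrence hint hz⟩,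
    h23, fun H3 => ((weylRecurrent_of_integral hint H3).measurableWeylRecurrence hint hz).topological⟩

end
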